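/- arXiv:2009.09394 — 14 statements merged into one kernel-verified Lean document; each statement's English description precedes it below -/
import Mathlib

section
/- A simple graph G on a vertex type V is 2-colorable (G.Colorable 2) if and only if there exist a type W, a simple graph H on W, a graph embedding f : G ↪g H, and vertices r b : W such that: H.Adj r b; every vertex w : W satisfies H.Adj w r ↔ ¬ H.Adj w b; and for all u w : W, if H.Adj u w then (H.Adj u r ↔ H.Adj w b). -/
universe u

namespace SimpleGraph

variable {V : Type u}

/-- The extension of `G` by one vertex for each color, in which a color vertex is adjacent to all
other color vertices and to all vertices of `G` that do not have this color. -/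
def addColorVertices (G : SimpleGraph V) {α : Type*} (c : V → α) : SimpleGraph (V ⊕ α) where
  Adj
    | .inl u, .inl v => G.Adj u v
    | .inl u, .inr i => c u ≠ i
    | .inr i, .inl u => c u ≠ i
    | .inr i, .inr j => i ≠ j
  symm := ⟨by
    rintro (u | i) (v | j) h
    · exact Adj.symm h
    · exact h
    · exact h
    · exact Ne.symm h⟩
  loopless := ⟨by
    rintro (u | i) h
    · exact G.irrefl h
    · exact h rfl⟩

/-- `G` embeds in its extension by color vertices. -/
def embeddingAddColorVertices (G : SimpleGraph V) {α : Type*} (c : V → α) :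
    G ↪g G.addColorVertices c where
  toFun := Sum.inl
  inj' := Sum.inl_injective
  map_rel_iff' := Iff.rfl

/-- The color of a vertex, where color vertices have the color they stand for, determines which
color vertices it is adjacent to. -/
theorem addColorVertices_adj_inr (G : SimpleGraph V) {α : Type*} (c : V → α) (w : V ⊕ α) (i : α) :
    (G.addColorVertices c).Adj w (Sum.inr i) ↔ Sum.elim c id w ≠ i := by
  cases w <;> rfl

/-- A coloring of `G` extends to the color vertices. -/
theorem Coloring.ne_of_addColorVertices_adj {G : SimpleGraph V} {α : Type*} (c : G.Coloring α)
    {u w : V ⊕ α} (h : (G.addColorVertices c).Adj u w) : Sum.elim c id u ≠ Sum.elim c id w := by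
  rcases u with u | i <;> rcases w with w | j
  · exact c.valid h
  · exact h
  · exact Ne.symm h
  · exact h

end SimpleGraph

theorem two_colorable_iff_modal {V : Type u} (G : SimpleGraph V) :
    G.Colorable 2 ↔
      ∃ (W : Type u) (H : SimpleGraph W) (_f : G ↪g H) (r b : W),
        H.Adj r b ∧
        (∀ w : W, H.Adj w r ↔ ¬ H.Adj w b) ∧
        (∀ u w : W, H.Adj u w → (H.Adj u r ↔ H.Adj w b)) := by
  constructor
  · rintro ⟨c⟩
    refine ⟨V ⊕ Fin 2, G.addColorVertices c, G.embeddingAddColorVertices c,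
      Sum.inr 0, Sum.inr 1, ?_, fun w ↦ ?_, fun u w h ↦ ?_⟩
    · exact (zero_ne_one : (0 : Fin 2) ≠ 1)
    · simp only [SimpleGraph.addColorVertices_adj_inr]
      generalize Sum.elim c id w = i
      revert i
      decide
    · have h := c.ne_of_addColorVertices_adj h
      simp only [SimpleGraph.addColorVertices_adj_inr]
      generalize Sum.elim c id u = i at *
      generalize Sum.elim c id w = j at *
      revert i j
      decide
  · rintro ⟨W, H, f, r, b, -, hrb, hadj⟩
    let c : H.Coloring Prop := SimpleGraph.Coloring.mk (fun w ↦ H.Adj w r) fun {u w} h heq ↦ by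
      have h₁ := hadj u w h
      have h₂ := hrb w
      have h₃ : H.Adj u r ↔ H.Adj w r := iff_of_eq heq
      tauto
    have hc : G.Colorable (Fintype.card Prop) :=
      SimpleGraph.Coloring.colorable (c.comp f.toHom)
    simpa using hc
end

section
/- For a simple graph G on a vertex type V, the type V is finite if and only if there exist a type W, a simple graph H on W, a graph embedding f : G ↪g H, and a vertex n : W such that, writing S for the set of H-neighbors of n: (i) the induced subgraph of H on S is connected; (ii) there exist distinct s e ∈ S such that s and e each have exactly one H-neighbor belonging to S, while every element of S other than s and e has exactly two H-neighbors belonging to S; and (iii) every vertex v : W with v ≠ n and v ∉ S has exactly one H-neighbor belonging to S, and distinct such vertices have distinct unique H-neighbors in S (the assignment of each such v to its unique H-neighbor in S is injective). -/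
universe u

namespace SimpleGraph

/-- A set of vertices closed under adjacency contains everything reachable from it. -/
theorem Reachable.mem_of_adj_closed {α : Type*} {K : SimpleGraph α} {T : Set α}
    (hT : ∀ x ∈ T, ∀ y, K.Adj x y → y ∈ T) {u v : α} (h : K.Reachable u v) (hu : u ∈ T) :
    v ∈ T := by
  obtain ⟨p⟩ := h
  induction p with
  | nil => exact hu
  | cons hadj _ ih => exact ih (hT _ hu _ hadj)

/-- A connected graph with two vertices of degree one and all others of degree two is finite. -/
theorem Connected.finite_of_ncard_neighborSet {α : Type*} {K : SimpleGraph α}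
    (hK : K.Connected) {s e : α} (hse : s ≠ e)
    (hs : (K.neighborSet s).ncard = 1) (he : (K.neighborSet e).ncard = 1)
    (ht : ∀ t, t ≠ s → t ≠ e → (K.neighborSet t).ncard = 2) : Finite α := by
  obtain ⟨p, hp⟩ := hK.exists_isPath s e
  have hlen : 0 < p.length := by
    rw [Nat.pos_iff_ne_zero]
    exact fun h => hse (Walk.eq_of_length_eq_zero h)
  have hclosed : ∀ x ∈ {x | x ∈ p.support}, ∀ y, K.Adj x y → y ∈ {x | x ∈ p.support} := by
    intro x hx y hxy
    obtain ⟨i, rfl, hi⟩ := Walk.mem_support_iff_exists_getVert.1 hx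
    have hle_one : ∀ {a b c : α}, (K.neighborSet a).ncard = 1 → K.Adj a b → K.Adj a c → b = c := by
      intro a b c h hb hc
      obtain ⟨d, hd⟩ := Set.ncard_eq_one.1 h
      have hb' : b ∈ ({d} : Set α) := hd ▸ hb
      have hc' : c ∈ ({d} : Set α) := hd ▸ hc
      exact hb'.trans hc'.symm
    rcases Nat.eq_zero_or_pos i with rfl | hi0
    · rw [Walk.getVert_zero] at hxy
      have h := p.adj_getVert_succ hlen
      rw [Walk.getVert_zero] at h
      rw [hle_one hs hxy h]
      exact p.getVert_mem_support _
    obtain ⟨j, rfl⟩ : ∃ j, i = j + 1 := ⟨i - 1, by omega⟩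
    have hprev := (p.adj_getVert_succ (i := j) (by omega)).symm
    rcases hi.eq_or_lt with hil | hil
    · rw [hil, Walk.getVert_length] at hprev hxy
      rw [hle_one he hxy hprev]
      exact p.getVert_mem_support _
    have hnext := p.adj_getVert_succ hil
    have hinj := hp.getVert_injOn
    have hcard := ht (p.getVert (j + 1))
      (fun h => by
        have := hinj (show j + 1 ≤ p.length from hi) (show 0 ≤ p.length by omega)
          (h.trans p.getVert_zero.symm)
        omega)
      (fun h => by
        have := hinj (show j + 1 ≤ p.length from hi) (show p.length ≤ p.length from le_rfl)
          (h.trans p.getVert_length.symm)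
        omega)
    have hne : p.getVert j ≠ p.getVert (j + 1 + 1) := fun h => by
      have := hinj (show j ≤ p.length by omega) (show j + 1 + 1 ≤ p.length from hil) h
      omega
    have heq : ({p.getVert j, p.getVert (j + 1 + 1)} : Set α) = K.neighborSet (p.getVert (j + 1)) :=
      Set.eq_of_subset_of_ncard_le (Set.pair_subset hprev hnext)
        (by rw [hcard, Set.ncard_pair hne]) (Set.finite_of_ncard_ne_zero (by omega))
    have hy : y ∈ ({p.getVert j, p.getVert (j + 1 + 1)} : Set α) := heq ▸ hxy
    rcases hy with rfl | rfl <;> exact p.getVert_mem_support _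
  exact Set.finite_univ_iff.1 (p.support.finite_toSet.subset fun v _ =>
    (hK.preconnected s v).mem_of_adj_closed hclosed p.start_mem_support)

theorem ncard_neighborSet_induce {α : Type*} (K : SimpleGraph α) (S : Set α) (t : S) :
    ((K.induce S).neighborSet t).ncard = (K.neighborSet t ∩ S).ncard := by
  rw [← Set.ncard_image_of_injective _ Subtype.val_injective]
  congr 1
  ext x
  simp [and_comm]

/-- The graph `G` together with a path on `k` vertices, an apex (`none`) joined to every path
vertex, and each vertex `v` of `G` joined to the path vertex `c v`. -/
def pathExtension {V : Type u} (G : SimpleGraph V) {k : ℕ} (c : V → Fin k) :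
    SimpleGraph (V ⊕ Option (Fin k)) where
  Adj
    | .inl v, .inl w => G.Adj v w
    | .inl v, .inr (some i) => c v = i
    | .inr (some i), .inl v => c v = i
    | .inr (some i), .inr (some j) => (pathGraph k).Adj i j
    | .inr none, .inr (some _) => True
    | .inr (some _), .inr none => True
    | _, _ => False
  symm := ⟨by
    rintro (v | _ | i) (w | _ | j) h <;> first
      | exact h
      | exact G.adj_symm h
      | exact (pathGraph k).adj_symm h⟩
  loopless := ⟨by
    rintro (v | _ | i) h
    · exact G.loopless.irrefl _ h
    · exact h
    · exact (pathGraph k).loopless.irrefl _ h⟩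

section pathExtension

variable {V : Type u} (G : SimpleGraph V) {k : ℕ} (c : V → Fin k)

theorem pathExtension_neighborSet_apex :
    (G.pathExtension c).neighborSet (.inr none) = Set.range fun i => .inr (some i) := by
  ext (v | _ | i) <;> simp [pathExtension]

theorem pathExtension_neighborSet_inter (i : Fin k) :
    (G.pathExtension c).neighborSet (.inr (some i)) ∩ Set.range (fun i => .inr (some i)) =
      (fun i => .inr (some i)) '' (pathGraph k).neighborSet i := by
  ext (v | _ | i) <;> simp [pathExtension]

theorem pathExtension_neighborSet_inl_inter (v : V) :
    (G.pathExtension c).neighborSet (.inl v) ∩ Set.range (fun i => .inr (some i)) =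
      {.inr (some (c v))} := by
  ext (v | _ | i) <;> simp [pathExtension, eq_comm]

end pathExtension

theorem pathGraph_neighborSet_zero (k : ℕ) :
    (pathGraph (k + 2)).neighborSet 0 = {1} := by
  ext i
  simp only [mem_neighborSet, pathGraph_adj, Set.mem_singleton_iff, Fin.ext_iff]
  simp
  omega

theorem pathGraph_neighborSet_last (k : ℕ) :
    (pathGraph (k + 2)).neighborSet (Fin.last (k + 1)) = {⟨k, by omega⟩} := by
  ext i
  simp only [mem_neighborSet, pathGraph_adj, Set.mem_singleton_iff, Fin.ext_iff, Fin.val_last]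
  omega

theorem ncard_pathGraph_neighborSet {k : ℕ} {i : Fin (k + 2)} (h0 : i ≠ 0)
    (hl : i ≠ Fin.last (k + 1)) : ((pathGraph (k + 2)).neighborSet i).ncard = 2 := by
  rw [Ne, Fin.ext_iff] at h0 hl
  simp only [Fin.val_zero, Fin.val_last] at h0 hl
  rw [Set.ncard_eq_two]
  refine ⟨⟨i - 1, by omega⟩, ⟨i + 1, by omega⟩, by simp only [Ne, Fin.mk.injEq]; omega, ?_⟩
  ext j
  simp only [mem_neighborSet, pathGraph_adj, Set.mem_insert_iff, Set.mem_singleton_iff,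
    Fin.ext_iff]
  omega

end SimpleGraph

open SimpleGraph in
theorem finite_iff_modal {V : Type u} (G : SimpleGraph V) :
    Finite V ↔
      ∃ (W : Type u) (H : SimpleGraph W) (_f : G ↪g H) (n : W),
        (H.induce (H.neighborSet n)).Connected ∧
        (∃ s ∈ H.neighborSet n, ∃ e ∈ H.neighborSet n, s ≠ e ∧
          (H.neighborSet s ∩ H.neighborSet n).ncard = 1 ∧
          (H.neighborSet e ∩ H.neighborSet n).ncard = 1 ∧
          ∀ t ∈ H.neighborSet n, t ≠ s → t ≠ e →
            (H.neighborSet t ∩ H.neighborSet n).ncard = 2) ∧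
        (∀ v : W, v ≠ n → v ∉ H.neighborSet n →
          (H.neighborSet v ∩ H.neighborSet n).ncard = 1) ∧
        (∀ v₁ v₂ : W, v₁ ≠ n → v₁ ∉ H.neighborSet n →
          v₂ ≠ n → v₂ ∉ H.neighborSet n →
          ∀ w ∈ H.neighborSet n, H.Adj v₁ w → H.Adj v₂ w → v₁ = v₂) := by
  constructor
  · intro hV
    obtain ⟨k, ⟨φ⟩⟩ := Finite.exists_equiv_fin V
    let c : V → Fin (k + 2) := fun v => Fin.castLE (by omega) (φ v)
    have hc : Function.Injective c := (Fin.castLE_injective _).comp φ.injective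
    have hι : Function.Injective fun i : Fin (k + 2) => (.inr (some i) : V ⊕ Option (Fin (k + 2))) :=
      Sum.inr_injective.comp (Option.some_injective _)
    refine ⟨V ⊕ Option (Fin (k + 2)), G.pathExtension c, ⟨⟨.inl, Sum.inl_injective⟩, Iff.rfl⟩,
      .inr none, ?_⟩
    rw [pathExtension_neighborSet_apex]
    refine ⟨?_, ⟨_, ⟨0, rfl⟩, _, ⟨Fin.last (k + 1), rfl⟩, ?_, ?_, ?_, ?_⟩, ?_, ?_⟩
    · let g : pathGraph (k + 2) →g (G.pathExtension c).induce
          (Set.range fun i => .inr (some i)) := ⟨fun i => ⟨.inr (some i), i, rfl⟩, fun h => h⟩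
      have hg : Function.Surjective g := by
        rintro ⟨_, i, rfl⟩
        exact ⟨i, rfl⟩
      exact (pathGraph_connected (k + 1)).map g hg
    · exact hι.ne (Fin.last_pos.ne)
    · rw [pathExtension_neighborSet_inter, Set.ncard_image_of_injective _ hι,
        pathGraph_neighborSet_zero, Set.ncard_singleton]
    · rw [pathExtension_neighborSet_inter, Set.ncard_image_of_injective _ hι,
        pathGraph_neighborSet_last, Set.ncard_singleton]
    · rintro _ ⟨i, rfl⟩ h0 hl
      rw [pathExtension_neighborSet_inter, Set.ncard_image_of_injective _ hι]
      exact ncard_pathGraph_neighborSet (fun h => h0 (h ▸ rfl)) (fun h => hl (h ▸ rfl))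
    · rintro (v | _ | i) hn hS
      · rw [pathExtension_neighborSet_inl_inter, Set.ncard_singleton]
      · exact absurd rfl hn
      · exact absurd ⟨i, rfl⟩ hS
    · rintro (v₁ | _ | i) (v₂ | _ | j) hn₁ hS₁ hn₂ hS₂ _ ⟨l, rfl⟩ h₁ h₂ <;>
        first
        | exact absurd rfl hn₁
        | exact absurd rfl hn₂
        | exact absurd ⟨_, rfl⟩ hS₁
        | exact absurd ⟨_, rfl⟩ hS₂
        | exact congrArg _ (hc (Eq.trans (b := l) h₁ (Eq.symm h₂)))
  · rintro ⟨W, H, f, n, hconn, ⟨s, hs, e, he, hse, hs1, he1, ht⟩, hone, hinj⟩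
    have hS : Finite (H.neighborSet n) := by
      refine hconn.finite_of_ncard_neighborSet (s := ⟨s, hs⟩) (e := ⟨e, he⟩)
        (fun h => hse (congrArg Subtype.val h)) ?_ ?_ fun t hts hte => ?_
      · rwa [ncard_neighborSet_induce]
      · rwa [ncard_neighborSet_induce]
      · rw [ncard_neighborSet_induce]
        exact ht t t.2 (fun h => hts (Subtype.ext h)) (fun h => hte (Subtype.ext h))
    have hex : ∀ v : {v : W // v ≠ n ∧ v ∉ H.neighborSet n},
        ∃ w : H.neighborSet n, H.Adj v w := fun v => by
      obtain ⟨w, hw⟩ := Set.nonempty_of_ncard_ne_zero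
        ((hone v v.2.1 v.2.2).trans_ne one_ne_zero)
      exact ⟨⟨w, hw.2⟩, hw.1⟩
    choose r hr using hex
    have hrest : Finite {v : W // v ≠ n ∧ v ∉ H.neighborSet n} :=
      Finite.of_injective r fun v₁ v₂ h => Subtype.ext <|
        hinj v₁ v₂ v₁.2.1 v₁.2.2 v₂.2.1 v₂.2.2 (r v₁) (r v₁).2 (hr v₁) (h ▸ hr v₂)
    have hW : Finite W := Set.finite_univ_iff.1 <|
      (((Set.finite_singleton n).union (Set.toFinite (H.neighborSet n))).union
        (Set.finite_coe_iff.1 hrest)).subset fun v _ => by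
          by_cases h : v = n
          · exact Or.inl (Or.inl h)
          · by_cases h' : v ∈ H.neighborSet n
            · exact Or.inl (Or.inr h')
            · exact Or.inr ⟨h, h'⟩
    exact Finite.of_injective f f.injective
end

section
/- For a simple graph G on a vertex type V, the type V is countable if and only if there exist a type W, a simple graph H on W, a graph embedding f : G ↪g H, and a vertex w₀ : W such that, writing S for the set of H-neighbors of w₀: (i) the induced subgraph of H on S is connected; (ii) there is exactly one element s ∈ S having exactly one H-neighbor belonging to S, and every element of S other than s has exactly two H-neighbors belonging to S; and (iii) every vertex v : W with v ≠ w₀ and v ∉ S has exactly one H-neighbor belonging to S, and distinct such vertices have distinct unique H-neighbors in S. -/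
universe u

/-- A connected graph all of whose neighbor sets are countable has countably many vertices. -/
theorem SimpleGraph.Connected.countable_of_countable_neighborSet {α : Type*} {G : SimpleGraph α}
    (hG : G.Connected) (h : ∀ v, (G.neighborSet v).Countable) : Countable α := by
  obtain ⟨s⟩ := hG.nonempty
  let B : ℕ → Set α := fun n ↦ Nat.rec {s} (fun _ A ↦ ⋃ v ∈ A, G.neighborSet v) n
  have hB : ∀ n, (B n).Countable := by
    intro n
    induction n with
    | zero => exact Set.countable_singleton s
    | succ n ih => exact ih.biUnion fun v _ ↦ h v
  have hstep : ∀ {u v : α}, G.Walk u v → ∀ n : ℕ, u ∈ B n → ∃ m, v ∈ B m := by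
    intro u v p
    induction p with
    | nil => exact fun n hn ↦ ⟨n, hn⟩
    | cons hadj _ ih => exact fun n hn ↦ ih (n + 1) (Set.mem_biUnion hn hadj)
  rw [← Set.countable_univ_iff]
  refine (Set.countable_iUnion hB).mono fun v _ ↦ ?_
  obtain ⟨p⟩ := hG.preconnected s v
  exact Set.mem_iUnion.2 (hstep p 0 rfl)

/-- The graph obtained from `G` by adding a ray indexed by `ℕ`, an apex `none` joined to all
vertices of the ray, and an edge from each vertex `v` of `G` to the vertex `e v` of the ray. -/
def SimpleGraph.addConedRay {V : Type u} (G : SimpleGraph V) (e : V → ℕ) :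
    SimpleGraph (V ⊕ Option ℕ) where
  Adj
    | .inl u, .inl v => G.Adj u v
    | .inl v, .inr (some n) => n = e v
    | .inr (some n), .inl v => n = e v
    | .inr none, .inr (some _) => True
    | .inr (some _), .inr none => True
    | .inr (some n), .inr (some m) => n = m + 1 ∨ m = n + 1
    | _, _ => False
  symm := ⟨by
    rintro (u | _ | n) (v | _ | m) h
    all_goals first
      | exact G.adj_symm h
      | exact Or.symm h
      | exact h⟩
  loopless := ⟨by
    rintro (u | _ | n) h
    · exact G.irrefl h
    · exact h
    · rcases h with h | h <;> omega⟩

namespace SimpleGraph.addConedRay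

variable {V : Type u} (G : SimpleGraph V) (e : V → ℕ)

theorem neighborSet_apex :
    (G.addConedRay e).neighborSet (.inr none) = Set.range fun n : ℕ ↦ .inr (some n) := by
  ext (v | _ | n) <;> simp [addConedRay]

theorem neighborSet_inl_inter (v : V) :
    (G.addConedRay e).neighborSet (.inl v) ∩ (G.addConedRay e).neighborSet (.inr none) =
      {.inr (some (e v))} := by
  ext (v | _ | n) <;> simp [addConedRay]

theorem neighborSet_zero_inter :
    (G.addConedRay e).neighborSet (.inr (some 0)) ∩
      (G.addConedRay e).neighborSet (.inr none) = {.inr (some 1)} := by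
  ext (v | _ | n) <;> simp [addConedRay]

theorem neighborSet_succ_inter (n : ℕ) :
    (G.addConedRay e).neighborSet (.inr (some (n + 1))) ∩
      (G.addConedRay e).neighborSet (.inr none) =
        {.inr (some n), .inr (some (n + 2))} := by
  ext (v | _ | m) <;> simp [addConedRay, eq_comm]

theorem connected_induce_neighborSet_apex :
    ((G.addConedRay e).induce ((G.addConedRay e).neighborSet (.inr none))).Connected := by
  have hmem (n : ℕ) :
      .inr (some n) ∈ (G.addConedRay e).neighborSet (.inr none) := trivial
  refine connected_iff_exists_forall_reachable _ |>.2 ⟨⟨_, hmem 0⟩, ?_⟩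
  rintro ⟨v | _ | n, hv⟩
  · exact hv.elim
  · exact hv.elim
  · induction n with
    | zero => exact Reachable.refl _
    | succ n ih =>
      refine (ih (hmem n)).trans (Adj.reachable ?_)
      exact Or.inr rfl

end SimpleGraph.addConedRay

open SimpleGraph.addConedRay in
theorem countable_iff_modal {V : Type u} (G : SimpleGraph V) :
    Countable V ↔
      ∃ (W : Type u) (H : SimpleGraph W) (_f : G ↪g H) (w₀ : W),
        (H.induce (H.neighborSet w₀)).Connected ∧
        (∃ s ∈ H.neighborSet w₀,
          (H.neighborSet s ∩ H.neighborSet w₀).ncard = 1 ∧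
          (∀ t ∈ H.neighborSet w₀, t ≠ s →
            (H.neighborSet t ∩ H.neighborSet w₀).ncard = 2) ∧
          (∀ t ∈ H.neighborSet w₀,
            (H.neighborSet t ∩ H.neighborSet w₀).ncard = 1 → t = s)) ∧
        (∀ v : W, v ≠ w₀ → v ∉ H.neighborSet w₀ →
          (H.neighborSet v ∩ H.neighborSet w₀).ncard = 1) ∧
        (∀ v₁ v₂ : W, v₁ ≠ w₀ → v₁ ∉ H.neighborSet w₀ →
          v₂ ≠ w₀ → v₂ ∉ H.neighborSet w₀ →
          ∀ w ∈ H.neighborSet w₀, H.Adj v₁ w → H.Adj v₂ w → v₁ = v₂) := by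
  constructor
  · intro hV
    obtain ⟨e, he⟩ := hV.exists_injective_nat
    have htwo (n : ℕ) : ((G.addConedRay e).neighborSet (.inr (some (n + 1))) ∩
        (G.addConedRay e).neighborSet (.inr none)).ncard = 2 := by
      rw [neighborSet_succ_inter, Set.ncard_pair]
      simp
    refine ⟨_, G.addConedRay e, ⟨.inl, Iff.rfl⟩, .inr none,
      connected_induce_neighborSet_apex G e, ⟨.inr (some 0), trivial, ?_, ?_, ?_⟩, ?_, ?_⟩
    · rw [neighborSet_zero_inter, Set.ncard_singleton]
    · rintro (v | _ | _ | n) ht hne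
      · exact ht.elim
      · exact ht.elim
      · exact (hne rfl).elim
      · exact htwo n
    · rintro (v | _ | _ | n) ht hcard
      · exact ht.elim
      · exact ht.elim
      · rfl
      · rw [htwo n] at hcard
        omega
    · rintro (v | _ | n) hne hv
      · rw [neighborSet_inl_inter, Set.ncard_singleton]
      · exact (hne rfl).elim
      · exact (hv trivial).elim
    · rintro (v₁ | _ | n₁) (v₂ | _ | n₂) hne₁ hv₁ hne₂ hv₂ (w | _ | n) hw h₁ h₂
      all_goals first
        | exact hw.elim
        | exact (hne₁ rfl).elim
        | exact (hne₂ rfl).elim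
        | exact (hv₁ trivial).elim
        | exact (hv₂ trivial).elim
        | exact congrArg Sum.inl (he (Eq.trans (Eq.symm h₁) h₂))
  · rintro ⟨W, H, f, w₀, hconn, ⟨s, hs, hs₁, ht, -⟩, hout, hinj⟩
    have hS : (H.neighborSet w₀).Countable := by
      refine hconn.countable_of_countable_neighborSet fun t ↦ ?_
      have hfin : (H.neighborSet t ∩ H.neighborSet w₀).Finite := by
        apply Set.finite_of_ncard_ne_zero
        by_cases hts : (t : W) = s
        · rw [hts, hs₁]
          exact one_ne_zero
        · rw [ht t t.2 hts]
          exact two_ne_zero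
      refine (hfin.countable.preimage Subtype.val_injective).mono fun u hu ↦ ?_
      exact ⟨hu, u.2⟩
    have hT : {v | v ≠ w₀ ∧ v ∉ H.neighborSet w₀}.Countable := by
      have hex : ∀ v, v ≠ w₀ ∧ v ∉ H.neighborSet w₀ → ∃ w ∈ H.neighborSet w₀, H.Adj v w := by
        rintro v ⟨hne, hv⟩
        obtain ⟨w, hw⟩ := Set.nonempty_of_ncard_ne_zero (hout v hne hv ▸ one_ne_zero)
        exact ⟨w, hw.2, hw.1⟩
      choose! g hgS hgAdj using hex
      refine Set.MapsTo.countable_of_injOn (f := g) hgS (fun v hv v' hv' h ↦ ?_) hS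
      exact hinj v v' hv.1 hv.2 hv'.1 hv'.2 (g v) (hgS v hv) (hgAdj v hv) (h ▸ hgAdj v' hv')
    have hW : Countable W := by
      rw [← Set.countable_univ_iff]
      refine ((hS.union hT).insert w₀).mono fun v _ ↦ ?_
      by_cases hne : v = w₀
      · exact Or.inl hne
      · by_cases hv : v ∈ H.neighborSet w₀
        · exact Or.inr (Or.inl hv)
        · exact Or.inr (Or.inr ⟨hne, hv⟩)
    exact f.injective.countable
end

section
/- For a simple graph G on a vertex type V, the cardinality of V is at most the continuum (Cardinal.mk V ≤ Cardinal.continuum) if and only if there exist a type W, a simple graph H on W, a graph embedding f : G ↪g H, and a vertex w₀ : W such that, writing S for the set of H-neighbors of w₀: (i) the induced subgraph of H on S is connected; (ii) there is exactly one element s ∈ S having exactly one H-neighbor belonging to S, and every element of S other than s has exactly two H-neighbors belonging to S; and (iii) for all vertices u v : W with u ≠ v, u ∉ S, v ∉ S, u ≠ w₀, and v ≠ w₀, there exists t ∈ S with (H.Adj u t ↔ ¬ H.Adj v t). -/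
universe u

namespace SimpleGraph

/-- A connected graph in which every neighborhood is countable has countably many vertices. -/
theorem Connected.countable_of_countable_neighborSet_s5 {W : Type*} {H : SimpleGraph W}
    (hH : H.Connected) (hc : ∀ x, (H.neighborSet x).Countable) : Countable W := by
  obtain ⟨s⟩ := hH.nonempty
  let B : ℕ → Set W := fun n => Nat.rec {s} (fun _ A => ⋃ x ∈ A, H.neighborSet x) n
  have hB : ∀ n, (B n).Countable := by
    intro n
    induction n with
    | zero => exact Set.countable_singleton s
    | succ n ih => exact ih.biUnion fun x _ => hc x
  have hwalk : ∀ {x y : W}, H.Walk x y → ∀ n, x ∈ B n → ∃ m, y ∈ B m := by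
    intro x y p
    induction p with
    | nil => exact fun n hn => ⟨n, hn⟩
    | cons h _ ih =>
      exact fun n hn => ih (n + 1) (Set.mem_biUnion hn h)
  rw [← Set.countable_univ_iff]
  refine (Set.countable_iUnion hB).mono fun y _ => ?_
  obtain ⟨p⟩ := hH.preconnected s y
  obtain ⟨m, hm⟩ := hwalk p 0 rfl
  exact Set.mem_iUnion.2 ⟨m, hm⟩

/-- If the vertices outside a countable set `S` and a vertex `w₀` are distinguished by their
neighbors in `S`, then there are at most continuum many vertices. -/
theorem mk_le_continuum_of_separated {W : Type u} (H : SimpleGraph W) (S : Set W) (w₀ : W)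
    (hS : S.Countable)
    (hsep : ∀ u v : W, u ≠ v → u ∉ S → v ∉ S → u ≠ w₀ → v ≠ w₀ →
      ∃ t ∈ S, (H.Adj u t ↔ ¬ H.Adj v t)) :
    Cardinal.mk W ≤ Cardinal.continuum := by
  have hT : (insert w₀ S).Countable := hS.insert w₀
  have hcompl : Cardinal.mk ↥(insert w₀ S)ᶜ ≤ Cardinal.continuum := by
    have hinj : Function.Injective
        (fun (v : ↥(insert w₀ S)ᶜ) => {t : S | H.Adj v t}) := by
      rintro ⟨u, hu⟩ ⟨v, hv⟩ huv
      by_contra hne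
      simp only [Set.mem_compl_iff, Set.mem_insert_iff, not_or] at hu hv
      obtain ⟨t, ht, hiff⟩ := hsep u v (fun h => hne (Subtype.ext h)) hu.2 hv.2 hu.1 hv.1
      have hmem : H.Adj u t ↔ H.Adj v t := Set.ext_iff.1 huv ⟨t, ht⟩
      tauto
    calc Cardinal.mk ↥(insert w₀ S)ᶜ ≤ Cardinal.mk (Set S) := Cardinal.mk_le_of_injective hinj
      _ = 2 ^ Cardinal.mk S := Cardinal.mk_set
      _ ≤ 2 ^ Cardinal.aleph0 :=
        Cardinal.power_le_power_left two_ne_zero (Cardinal.le_aleph0_iff_set_countable.2 hS)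
      _ = Cardinal.continuum := Cardinal.two_power_aleph0
  rw [← Cardinal.mk_sum_compl (insert w₀ S)]
  exact Cardinal.add_le_of_le Cardinal.aleph0_le_continuum
    ((Cardinal.le_aleph0_iff_set_countable.2 hT).trans Cardinal.aleph0_le_continuum) hcompl

/-- The extension of `G` by a ray `0, 1, 2, …` and an apex `none` adjacent to exactly the ray,
where a vertex `v` of `G` is adjacent to the elements of `e v` on the ray. -/
def rayExtension {V : Type u} (G : SimpleGraph V) (e : V → Set ℕ) :
    SimpleGraph (V ⊕ Option ℕ) where
  Adj
    | .inl u, .inl v => G.Adj u v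
    | .inl u, .inr (some n) => n ∈ e u
    | .inr (some n), .inl u => n ∈ e u
    | .inr (some m), .inr (some n) => m + 1 = n ∨ n + 1 = m
    | .inr (some _), .inr none => True
    | .inr none, .inr (some _) => True
    | _, _ => False
  symm := ⟨by
    rintro (u | _ | m) (v | _ | n) h
    all_goals first | exact h | exact G.adj_symm h | exact Or.symm h⟩
  loopless := ⟨by
    rintro (u | _ | m) h
    · exact G.loopless.irrefl u h
    · exact h
    · rcases h with h | h <;> omega⟩

section rayExtension

variable {V : Type u} (G : SimpleGraph V) (e : V → Set ℕ)

/-- The canonical embedding of `G` into its ray extension. -/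
def rayExtensionEmbedding : G ↪g rayExtension G e where
  toFun := Sum.inl
  inj' := Sum.inl_injective
  map_rel_iff' := Iff.rfl

theorem rayExtension_neighborSet_apex :
    (rayExtension G e).neighborSet (.inr none) = Set.range fun n => .inr (some n) := by
  ext (v | _ | n) <;> simp [rayExtension]

theorem rayExtension_neighborSet_inter_ray (m : ℕ) :
    (rayExtension G e).neighborSet (.inr (some m)) ∩ (Set.range fun n => .inr (some n)) =
      (fun n => .inr (some n)) '' {n : ℕ | m + 1 = n ∨ n + 1 = m} := by
  ext (v | _ | n) <;> simp [rayExtension]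

theorem ncard_rayExtension_neighborSet_inter_ray (m : ℕ) :
    ((rayExtension G e).neighborSet (.inr (some m)) ∩
      (Set.range fun n => .inr (some n))).ncard = if m = 0 then 1 else 2 := by
  rw [rayExtension_neighborSet_inter_ray, Set.ncard_image_of_injective _
    (fun _ _ h => Option.some_injective ℕ (Sum.inr_injective h))]
  rcases m with _ | m
  · simp
  · have h : {n : ℕ | m + 1 + 1 = n ∨ n + 1 = m + 1} = {m, m + 2} := by
      ext n
      simp only [Set.mem_ofPred_eq, Set.mem_insert_iff, Set.mem_singleton_iff]
      omega
    rw [h, Set.ncard_pair (by omega), if_neg (by omega)]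

theorem rayExtension_induce_ray_connected :
    ((rayExtension G e).induce (Set.range fun n => .inr (some n))).Connected := by
  rw [connected_iff_exists_forall_reachable]
  refine ⟨⟨.inr (some 0), 0, rfl⟩, ?_⟩
  rintro ⟨_, n, rfl⟩
  induction n with
  | zero => exact Reachable.refl _
  | succ n ih => exact ih.trans (Adj.reachable (Or.inl rfl : n + 1 = n + 1 ∨ _))

end rayExtension

end SimpleGraph

theorem le_continuum_iff_modal {V : Type u} (G : SimpleGraph V) :
    Cardinal.mk V ≤ Cardinal.continuum ↔
      ∃ (W : Type u) (H : SimpleGraph W) (_f : G ↪g H) (w₀ : W),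
        (H.induce (H.neighborSet w₀)).Connected ∧
        (∃ s ∈ H.neighborSet w₀,
          (H.neighborSet s ∩ H.neighborSet w₀).ncard = 1 ∧
          (∀ t ∈ H.neighborSet w₀, t ≠ s →
            (H.neighborSet t ∩ H.neighborSet w₀).ncard = 2) ∧
          (∀ t ∈ H.neighborSet w₀,
            (H.neighborSet t ∩ H.neighborSet w₀).ncard = 1 → t = s)) ∧
        (∀ u v : W, u ≠ v → u ∉ H.neighborSet w₀ → v ∉ H.neighborSet w₀ →
          u ≠ w₀ → v ≠ w₀ →
          ∃ t ∈ H.neighborSet w₀, (H.Adj u t ↔ ¬ H.Adj v t)) := by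
  constructor
  · intro hV
    have hV' : Cardinal.lift.{0} (Cardinal.mk V) ≤ Cardinal.lift.{u} (Cardinal.mk (Set ℕ)) := by
      simpa using hV
    obtain ⟨e⟩ := Cardinal.lift_mk_le'.1 hV'
    refine ⟨V ⊕ Option ℕ, G.rayExtension e, G.rayExtensionEmbedding e, .inr none, ?_⟩
    rw [SimpleGraph.rayExtension_neighborSet_apex]
    refine ⟨G.rayExtension_induce_ray_connected e, ⟨.inr (some 0), ⟨0, rfl⟩, ?_, ?_, ?_⟩, ?_⟩
    · simp [SimpleGraph.ncard_rayExtension_neighborSet_inter_ray]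
    · rintro _ ⟨m, rfl⟩ hm
      have hm0 : m ≠ 0 := by rintro rfl; exact hm rfl
      simp [SimpleGraph.ncard_rayExtension_neighborSet_inter_ray, hm0]
    · rintro _ ⟨m, rfl⟩ hm
      by_contra hne
      have hm0 : m ≠ 0 := by rintro rfl; exact hne rfl
      simp [SimpleGraph.ncard_rayExtension_neighborSet_inter_ray, hm0] at hm
    · rintro (u | _ | m) (v | _ | n) huv hu hv hu' hv'
      case inl.inl =>
        have hne : e u ≠ e v := fun h => huv (congrArg _ (e.injective h))
        obtain ⟨n, hn⟩ : ∃ n, ¬ (n ∈ e u ↔ n ∈ e v) := by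
          by_contra! h
          exact hne (Set.ext h)
        refine ⟨.inr (some n), ⟨n, rfl⟩, ?_⟩
        change n ∈ e u ↔ ¬ n ∈ e v
        tauto
      all_goals simp at hu hv hu' hv'
  · rintro ⟨W, H, f, w₀, hconn, ⟨s, -, hs1, hs2, -⟩, hsep⟩
    refine (Cardinal.mk_le_of_injective f.injective).trans
      (H.mk_le_continuum_of_separated (H.neighborSet w₀) w₀ ?_ hsep)
    refine Set.countable_coe_iff.1 (hconn.countable_of_countable_neighborSet_s5 ?_)
    rintro ⟨t, ht⟩
    have hfin : (H.neighborSet t ∩ H.neighborSet w₀).Finite := by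
      apply Set.finite_of_ncard_ne_zero
      by_cases hts : t = s
      · rw [hts, hs1]; exact one_ne_zero
      · rw [hs2 t ht hts]; exact two_ne_zero
    refine (hfin.countable.preimage Subtype.val_injective).mono fun x hx => ?_
    exact ⟨hx, x.2⟩
end

section
/- Let L be a first-order language and let M, N, H be L-structures. Suppose g : M ↪ₑ[L] N is an L-elementary embedding and f : M ↪[L] H is an L-embedding. Then there exist an L-structure P, an L-elementary embedding j : H ↪ₑ[L] P, and an L-embedding k : N ↪[L] P such that k (g x) = j (f x) for all x : M. -/
open FirstOrder

universe u

namespace FirstOrder.Language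

open Filter

variable {L : Language} {M N H : Type*} [L.Structure M] [L.Structure N] [L.Structure H]

/-- A formula satisfied by the identity assignment of an elementary extension `N` of `M` is
satisfied in `M` by an assignment that is a retraction of `N` onto `M`. -/
theorem ElementaryEmbedding.exists_leftInverse_realize (g : M ↪ₑ[L] N) {φ : L.Formula N}
    (hφ : φ.Realize (id : N → N)) :
    ∃ t : N → M, Function.LeftInverse t g ∧ φ.Realize t := by
  classical
  have hM (n : N) : Nonempty M := g.elementarilyEquivalent.nonempty_iff.2 ⟨n⟩
  let r : φ.freeVarFinset → M ⊕ φ.freeVarFinset := fun a ↦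
    if h : ∃ x, g x = a then Sum.inl h.choose else Sum.inr a
  let ψ : L.Formula (M ⊕ φ.freeVarFinset) := φ.restrictFreeVar r
  have hN : (ψ.iExs φ.freeVarFinset).Realize (g ∘ id) := by
    rw [Formula.realize_iExs]
    refine ⟨Subtype.val, (BoundedFormula.realize_restrictFreeVar id fun a ↦ ?_).2 hφ⟩
    by_cases h : ∃ x, g x = a
    · simp [r, dif_pos h, h.choose_spec]
    · simp [r, dif_neg h]
  obtain ⟨w, hw⟩ := Formula.realize_iExs.1 ((g.map_formula _ _).1 hN)
  let t : N → M := fun n ↦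
    if h : ∃ x, g x = n then h.choose
    else if h : n ∈ φ.freeVarFinset then w ⟨n, h⟩ else (hM n).some
  refine ⟨t, fun x ↦ ?_, (BoundedFormula.realize_restrictFreeVar t fun a ↦ ?_).1 hw⟩
  · simp [t]
  · by_cases h : ∃ x, g x = a
    · simp [r, t, dif_pos h]
    · simp [r, t, dif_neg h]

/-- An elementary extension `N` of `M` embeds over `M` into an ultrapower of `M` indexed by the
functions `N → M`, by sending `n` to the class of evaluation at `n`. -/
theorem ElementaryEmbedding.exists_ultrafilter (g : M ↪ₑ[L] N) :
    ∃ U : Ultrafilter (N → M), (∀ᶠ t in (U : Filter (N → M)), Function.LeftInverse t g) ∧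
      ∀ φ : L.Formula N, φ.Realize (id : N → N) →
        ∀ᶠ t in (U : Filter (N → M)), φ.Realize t := by
  let T := {φ : L.Formula N // φ.Realize (id : N → N)}
  let S : T → Set (N → M) := fun φ ↦ {t | Function.LeftInverse t g ∧ φ.1.Realize t}
  have : Nonempty T := ⟨⟨⊤, Formula.realize_top.2 trivial⟩⟩
  have hne : NeBot (⨅ φ, 𝓟 (S φ)) := by
    refine iInf_neBot_of_directed' (fun φ ψ ↦ ?_) fun φ ↦
      principal_neBot_iff.2 (g.exists_leftInverse_realize φ.2)
    refine ⟨⟨φ.1 ⊓ ψ.1, Formula.realize_inf.2 ⟨φ.2, ψ.2⟩⟩, ?_, ?_⟩ <;>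
      refine principal_mono.2 fun t ht ↦ ⟨ht.1, ?_⟩
    · exact (Formula.realize_inf.1 ht.2).1
    · exact (Formula.realize_inf.1 ht.2).2
  have hS (φ : T) : S φ ∈ Ultrafilter.of (⨅ φ, 𝓟 (S φ)) :=
    Ultrafilter.of_le _ (mem_iInf_of_mem φ (mem_principal_self _))
  exact ⟨Ultrafilter.of (⨅ φ, 𝓟 (S φ)), mem_of_superset (hS (Classical.arbitrary T)) fun _ h ↦ h.1,
    fun φ hφ ↦ mem_of_superset (hS ⟨φ, hφ⟩) fun _ h ↦ h.2⟩

/-- The diagonal elementary embedding of a structure into its ultrapower. -/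
def Ultraproduct.diagonal [Nonempty H] {ι : Type*} (U : Ultrafilter ι) :
    H ↪ₑ[L] (U : Filter ι).Product fun _ ↦ H where
  toFun x := ((fun _ ↦ x : ι → H) : (U : Filter ι).Product fun _ ↦ H)
  map_formula' _ φ x :=
    (Ultraproduct.realize_formula_cast φ fun i _ ↦ x i).trans eventually_const

/-- A family of functions into `H` which eventually preserves every function and eventually
preserves and reflects equality and every relation induces an embedding into the ultrapower. -/
def Ultraproduct.embeddingOfEventually {ι : Type*} (U : Ultrafilter ι) (e : ι → N → H)
    (hinj : ∀ x y, x ≠ y → ∀ᶠ i in (U : Filter ι), e i x ≠ e i y)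
    (hfun : ∀ {n} (F : L.Functions n) (x : Fin n → N),
      ∀ᶠ i in (U : Filter ι), e i (Structure.funMap F x) = Structure.funMap F (e i ∘ x))
    (hrel : ∀ {n} (R : L.Relations n) (x : Fin n → N),
      ∀ᶠ i in (U : Filter ι), (Structure.RelMap R (e i ∘ x) ↔ Structure.RelMap R x)) :
    N ↪[L] (U : Filter ι).Product fun _ ↦ H where
  toFun x := ((fun i ↦ e i x : ι → H) : (U : Filter ι).Product fun _ ↦ H)
  inj' x y h := by
    by_contra hxy
    have h' : ∀ᶠ i in (U : Filter ι), e i x = e i y := Quotient.exact h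
    obtain ⟨i, hi, hi'⟩ := (h'.and (hinj x y hxy)).exists
    exact hi' hi
  map_fun' F x :=
    (Quotient.sound (hfun F x)).trans
      (Ultraproduct.funMap_cast (u := U) F fun j i ↦ e i (x j)).symm
  map_rel' R x :=
    (relMap_quotient_mk' ((U : Filter ι).productSetoid fun _ ↦ H) R
      fun j i ↦ e i (x j)).trans
      ((eventually_congr (hrel R x)).trans eventually_const)

/-- An empty extension of `M` embeds into every extension of `M`. -/
def Embedding.ofIsEmpty [IsEmpty N] (g : M ↪[L] N) (f : M ↪[L] H) : N ↪[L] H where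
  toFun := isEmptyElim
  inj' := isEmptyElim
  map_fun' F x := isEmptyElim (Structure.funMap F x)
  map_rel' R x := by
    let y : _ → M := fun i ↦ isEmptyElim (x i)
    have hg : x = g ∘ y := funext fun i ↦ isEmptyElim (x i)
    have hf : isEmptyElim ∘ x = f ∘ y := funext fun i ↦ isEmptyElim (x i)
    rw [hf, hg, f.map_rel, g.map_rel]

end FirstOrder.Language

theorem elementary_amalgamation {L : Language} {M N H : Type u}
    [L.Structure M] [L.Structure N] [L.Structure H]
    (g : M ↪ₑ[L] N) (f : M ↪[L] H) :
    ∃ (P : Type u) (_ : L.Structure P) (j : H ↪ₑ[L] P) (k : N ↪[L] P),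
      ∀ x : M, k (g x) = j (f x) := by
  open FirstOrder.Language Structure Filter in
  cases isEmpty_or_nonempty H with
  | inl hH =>
    have : IsEmpty N := not_nonempty_iff.1 fun hN ↦
      (g.elementarilyEquivalent.nonempty_iff.2 hN).elim fun x ↦ hH.elim (f x)
    exact ⟨H, inferInstance, .refl L H, .ofIsEmpty g.toEmbedding f, fun x ↦ isEmptyElim (g x)⟩
  | inr hH =>
    obtain ⟨U, hU, hφ⟩ := g.exists_ultrafilter
    refine ⟨(U : Filter (N → M)).Product fun _ ↦ H, inferInstance, Ultraproduct.diagonal U,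
      Ultraproduct.embeddingOfEventually U (fun t n ↦ f (t n)) (fun x y hxy ↦ ?_)
        (fun F x ↦ ?_) (fun R x ↦ ?_), fun x ↦ Quotient.sound (hU.mono fun t ht ↦ congrArg f (ht x))⟩
    · refine (hφ ((Term.var x).equal (Term.var y)).not (by simpa using hxy)).mono fun t ht ↦ ?_
      simpa using ht
    · refine (hφ ((Term.func F fun i ↦ Term.var (x i)).equal (Term.var (funMap F x)))
        (by simp)).mono fun t ht ↦ ?_
      rw [Formula.realize_equal] at ht
      exact (congrArg f ht.symm).trans (f.map_fun F (t ∘ x))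
    · let φ : L.Formula N := R.formula fun i ↦ Term.var (x i)
      have h : ∀ᶠ t in (U : Filter (N → M)), (RelMap R (t ∘ x) ↔ RelMap R x) := by
        by_cases hR : RelMap R x
        · refine (hφ φ (Formula.realize_rel.2 hR)).mono fun t ht ↦ ?_
          exact iff_of_true (Formula.realize_rel.1 ht) hR
        · refine (hφ φ.not (Formula.realize_not.2 (mt Formula.realize_rel.1 hR))).mono fun t ht ↦ ?_
          exact iff_of_false (fun h ↦ Formula.realize_not.1 ht (Formula.realize_rel.2 h)) hR
      exact h.mono fun t ht ↦ (f.map_rel R (t ∘ x)).trans ht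
end

section
/- Let L be a first-order language and let M and N be elementarily equivalent L-structures (every L-sentence holds in M if and only if it holds in N). Then there exist an L-structure P and L-elementary embeddings M ↪ₑ[L] P and N ↪ₑ[L] P. -/
open FirstOrder

universe u

/-- A formula realized in a structure can be realized in any elementarily equivalent one. -/
theorem FirstOrder.Language.ElementarilyEquivalent.exists_realize {L : Language}
    {M N α : Type*} [L.Structure M] [L.Structure N] (h : M ≅[L] N) (φ : L.Formula α)
    {v : α → M} (hv : φ.Realize v) : ∃ w : α → N, φ.Realize w := by
  classical
  have hM : M ⊨ φ.exClosure :=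
    (Language.Formula.realize_exClosure φ).2
      ⟨fun a => v a,
        (Language.BoundedFormula.realize_restrictFreeVar (f := id) v fun _ => rfl).2 hv⟩
  obtain ⟨w, hw⟩ := (Language.Formula.realize_exClosure φ).1 ((h.realize_sentence _).1 hM)
  have hN (a : α) : Nonempty N := h.nonempty_iff.1 ⟨v a⟩
  let w' : α → N := fun a =>
    if ha : a ∈ φ.freeVarFinset then w ⟨a, ha⟩ else Classical.choice (hN a)
  exact ⟨w', (Language.BoundedFormula.realize_restrictFreeVar w' fun a => by simp [w']).1 hw⟩

/-- If `M` and `N` are elementarily equivalent, some ultrafilter on the set of maps `M → N`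
concentrates on the maps realizing any given formula that is true in `M` at the identity
assignment. -/
theorem FirstOrder.Language.ElementarilyEquivalent.exists_ultrafilter {L : Language}
    {M N : Type*} [L.Structure M] [L.Structure N] (h : M ≅[L] N) :
    ∃ U : Ultrafilter (M → N), ∀ φ : L.Formula M, φ.Realize (id : M → M) →
      ∀ᶠ v in (U : Filter (M → N)), φ.Realize v := by
  let s (φ : {φ : L.Formula M // φ.Realize (id : M → M)}) : Set (M → N) := {v | φ.1.Realize v}
  have : Nonempty {φ : L.Formula M // φ.Realize (id : M → M)} :=
    ⟨⟨⊤, Language.Formula.realize_top.2 trivial⟩⟩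
  have hdir : Directed (· ≥ ·) fun φ => Filter.principal (s φ) := fun φ ψ =>
    ⟨⟨φ.1 ⊓ ψ.1, Language.Formula.realize_inf.2 ⟨φ.2, ψ.2⟩⟩,
      Filter.principal_mono.2 fun _ hv => (Language.Formula.realize_inf.1 hv).1,
      Filter.principal_mono.2 fun _ hv => (Language.Formula.realize_inf.1 hv).2⟩
  have : (⨅ φ, Filter.principal (s φ)).NeBot :=
    Filter.iInf_neBot_of_directed' hdir fun φ =>
      Filter.principal_neBot_iff.2 (h.exists_realize φ.1 φ.2)
  exact ⟨Ultrafilter.of _, fun φ hφ => Ultrafilter.of_le _ <|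
    Filter.mem_iInf_of_mem (f := fun φ => Filter.principal (s φ)) ⟨φ, hφ⟩ (Filter.mem_principal_self _)⟩

theorem elementarily_equivalent_joint_embedding {L : Language} {M N : Type u}
    [L.Structure M] [L.Structure N] (h : M ≅[L] N) :
    ∃ (P : Type u) (_ : L.Structure P),
      Nonempty (M ↪ₑ[L] P) ∧ Nonempty (N ↪ₑ[L] P) := by
  rcases isEmpty_or_nonempty N with hN | hN
  · have : IsEmpty M := not_nonempty_iff.1 fun hM => not_nonempty_iff.2 hN (h.nonempty_iff.1 hM)
    refine ⟨N, inferInstance, ⟨⟨isEmptyElim, fun n φ x => ?_⟩⟩, ⟨.refl L N⟩⟩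
    have : IsEmpty (Fin n) := Function.isEmpty x
    constructor <;> intro hφ
    · obtain ⟨w, hw⟩ := h.symm.exists_realize φ hφ
      rwa [Subsingleton.elim x w]
    · obtain ⟨w, hw⟩ := h.exists_realize φ hφ
      rwa [Subsingleton.elim (_ ∘ x) w]
  obtain ⟨U, hU⟩ := h.exists_ultrafilter
  refine ⟨(U : Filter (M → N)).Product fun _ => N, inferInstance,
    ⟨⟨fun m => ((fun v => v m : (M → N) → N) : (U : Filter (M → N)).Product fun _ => N),
      fun n φ x => ?_⟩⟩,
    ⟨⟨fun a => ((fun _ => a : (M → N) → N) : (U : Filter (M → N)).Product fun _ => N),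
      fun n φ x => ?_⟩⟩⟩
  · refine (Language.Ultraproduct.realize_formula_cast (M := fun _ : M → N => N) φ
      fun i v => v (x i)).trans ?_
    have key (ψ : L.Formula (Fin n)) (hψ : ψ.Realize x) :
        ∀ᶠ v in (U : Filter (M → N)), ψ.Realize fun i => v (x i) := by
      simpa only [Language.Formula.realize_relabel, Function.comp_def] using
        hU (ψ.relabel x) (Language.Formula.realize_relabel.2 hψ)
    refine ⟨fun hφ => ?_, key φ⟩
    by_contra hx
    obtain ⟨v, hv, hv'⟩ := (hφ.and (key φ.not (Language.Formula.realize_not.2 hx))).exists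
    exact Language.Formula.realize_not.1 hv' hv
  · exact (Language.Ultraproduct.realize_formula_cast φ fun i _ => x i).trans
      Filter.eventually_const
end

section
/- Let L be a first-order language, M an L-structure, n : ℕ, and a b : Fin n → M two tuples realizing the same complete type in M, i.e., for every formula φ : L.Formula (Fin n), φ.Realize a holds in M if and only if φ.Realize b holds in M. Then there exist an L-structure N, an L-elementary embedding e : M ↪ₑ[L] N, and an L-automorphism σ : N ≃[L] N such that σ (e (a i)) = e (b i) for every i : Fin n. -/
open FirstOrder

universe u

namespace FirstOrder.Language

open Filter Structure

/-- A formula satisfied by the elements of `Y` is satisfied in `X` by an assignment of those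
elements which extends a given elementary correspondence. -/
theorem exists_realize_extending {L : Language} {A : Type*} {X Y : Type*}
    [L.Structure X] [L.Structure Y] [Nonempty X] {f : A → X} {e : A → Y}
    (h : ∀ φ : L.Formula A, φ.Realize f ↔ φ.Realize e) (φ : L.Formula Y) (hφ : φ.Realize id) :
    ∃ s : Y → X, (∀ a, s (e a) = f a) ∧ φ.Realize s := by
  classical
  have hef : ∀ a b, e a = e b → f a = f b := fun a b hab => by
    have := h ((var a : L.Term A).equal (var b))
    simp only [Formula.realize_equal, Term.realize_var] at this
    exact this.2 hab
  let p : φ.freeVarFinset → A ⊕ φ.freeVarFinset := fun y =>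
    if hy : ∃ a, e a = y then Sum.inl hy.choose else Sum.inr y
  let ψ : L.Formula (A ⊕ φ.freeVarFinset) := BoundedFormula.restrictFreeVar φ p
  have hψ : (ψ.iExs φ.freeVarFinset).Realize e := by
    rw [Formula.realize_iExs]
    refine ⟨fun y => y, (BoundedFormula.realize_restrictFreeVar id fun y => ?_).2 hφ⟩
    by_cases hy : ∃ a, e a = y
    · simp [p, hy, hy.choose_spec]
    · simp [p, hy]
  obtain ⟨t, ht⟩ := Formula.realize_iExs.1 ((h _).2 hψ)
  let s : Y → X := fun y =>
    if hy : ∃ a, e a = y then f hy.choose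
    else if hy' : y ∈ φ.freeVarFinset then t ⟨y, hy'⟩ else Classical.arbitrary X
  refine ⟨s, fun a => ?_, (BoundedFormula.realize_restrictFreeVar s fun y => ?_).1 ht⟩
  · have hy : ∃ b, e b = e a := ⟨a, rfl⟩
    simp only [s, dif_pos hy]
    exact hef _ _ hy.choose_spec
  · by_cases hy : ∃ a, e a = y
    · simp [p, s, hy]
    · simp [p, s, hy]

/-- Elementary amalgamation, realized by an ultrapower of `X`. -/
theorem exists_elementary_amalgam {L : Language} {A : Type*} {X Y : Type u}
    [L.Structure X] [L.Structure Y] [Nonempty X] {f : A → X} {e : A → Y}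
    (h : ∀ φ : L.Formula A, φ.Realize f ↔ φ.Realize e) :
    ∃ (Z : Type u) (_ : L.Structure Z) (_ : Nonempty Z) (g : X ↪ₑ[L] Z) (k : Y ↪ₑ[L] Z),
      ∀ a, g (f a) = k (e a) := by
  let I : Type u := {s : Y → X // ∀ a, s (e a) = f a}
  let D : {φ : L.Formula Y // φ.Realize id} → Set I := fun φ => {s | φ.1.Realize s.1}
  have : Nonempty {φ : L.Formula Y // φ.Realize id} := ⟨⟨⊤, Formula.realize_top.2 trivial⟩⟩
  have hD : (⨅ φ, 𝓟 (D φ)).NeBot := by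
    obtain ⟨s, hs, -⟩ := exists_realize_extending h ⊤ (Formula.realize_top.2 trivial)
    have : Nonempty I := ⟨⟨s, hs⟩⟩
    refine iInf_neBot_of_directed (fun φ ψ => ?_) fun φ => ?_
    · refine ⟨⟨φ.1 ⊓ ψ.1, Formula.realize_inf.2 ⟨φ.2, ψ.2⟩⟩, ?_, ?_⟩
      · exact principal_mono.2 fun s hs => (Formula.realize_inf.1 hs).1
      · exact principal_mono.2 fun s hs => (Formula.realize_inf.1 hs).2
    · obtain ⟨s, hs, hs'⟩ := exists_realize_extending h φ.1 φ.2
      exact principal_neBot_iff.2 ⟨⟨s, hs⟩, hs'⟩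
  let U : Ultrafilter I := Ultrafilter.of (⨅ φ, 𝓟 (D φ))
  have hU : ∀ φ : L.Formula Y, φ.Realize id → ∀ᶠ s : I in U, φ.Realize s.1 := fun φ hφ =>
    Ultrafilter.of_le _ (mem_iInf_of_mem ⟨φ, hφ⟩ (mem_principal_self _))
  let toZ : (I → X) → (U : Filter I).Product fun _ => X := fun x => Quotient.mk _ x
  refine ⟨(U : Filter I).Product fun _ => X, inferInstance, inferInstance,
    ⟨fun x => toZ fun _ => x, fun n φ x => ?_⟩, ⟨fun y => toZ fun s => s.1 y, fun n φ x => ?_⟩,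
    fun a => ?_⟩
  · refine (Ultraproduct.realize_formula_cast φ fun i _ => x i).trans ?_
    exact eventually_const
  · refine (Ultraproduct.realize_formula_cast φ fun i (s : I) => s.1 (x i)).trans
      ⟨fun hx => ?_, ?_⟩
    · by_contra hn
      have hn' := hU (φ.relabel x).not (by simpa [Formula.realize_relabel] using hn)
      obtain ⟨s, hs, hs'⟩ := (hx.and hn').exists
      rw [Formula.realize_not, Formula.realize_relabel] at hs'
      exact hs' hs
    · intro hx
      filter_upwards [hU (φ.relabel x) (by simpa [Formula.realize_relabel] using hx)] with s hs
      exact Formula.realize_relabel.1 hs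
  · exact congrArg toZ (funext fun s => (s.2 a).symm)

/-- The canonical maps into the direct limit of a directed system of elementary embeddings are
elementary. -/
theorem DirectLimit.realize_of {L : Language} {ι : Type*} [Preorder ι] [IsDirectedOrder ι]
    [Nonempty ι] {G : ι → Type*} [∀ i, L.Structure (G i)] {f : ∀ i j, i ≤ j → G i ↪[L] G j}
    [DirectedSystem G fun i j h => f i j h]
    (hf : ∀ i j hij, ∃ g : G i ↪ₑ[L] G j, ⇑g = f i j hij) {α : Type*} {n : ℕ}
    (φ : L.BoundedFormula α n) (i : ι) (v : α → G i) (x : Fin n → G i) :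
    φ.Realize (DirectLimit.of L ι G f i ∘ v) (DirectLimit.of L ι G f i ∘ x) ↔ φ.Realize v x := by
  induction φ generalizing i with
  | falsum => rfl
  | equal t₁ t₂ =>
    simp only [BoundedFormula.Realize, ← Sum.comp_elim, HomClass.realize_term]
    exact (DirectLimit.of L ι G f i).injective.eq_iff
  | rel R ts =>
    simp only [BoundedFormula.Realize, ← Sum.comp_elim, HomClass.realize_term]
    exact (DirectLimit.of L ι G f i).map_rel R _
  | imp φ ψ ihφ ihψ => simp only [BoundedFormula.Realize, ihφ, ihψ]
  | all φ ih =>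
    refine ⟨fun h y => ?_, fun h z => ?_⟩
    · rw [← ih, Fin.comp_snoc]
      exact h _
    · obtain ⟨j, y, rfl⟩ := DirectLimit.exists_of z
      obtain ⟨k, hik, hjk⟩ := exists_ge_ge i j
      obtain ⟨g, hg⟩ := hf i k hik
      have hik' : ⇑(DirectLimit.of L ι G f i) = DirectLimit.of L ι G f k ∘ g := funext fun b => by
        rw [Function.comp_apply, hg]
        exact (DirectLimit.of_f (hij := hik)).symm
      rw [hik', Function.comp_assoc, Function.comp_assoc, ← DirectLimit.of_f (hij := hjk), ← Fin.comp_snoc, ih]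
      exact (g.map_boundedFormula φ.all v x).2 h _

/-- A pair of elementary embeddings with common domain and codomain. -/
structure ElementaryPair (L : Language) where
  /-- The common domain. -/
  dom : Type u
  /-- The common codomain. -/
  cod : Type u
  [structureDom : L.Structure dom]
  [structureCod : L.Structure cod]
  [nonempty_cod : Nonempty cod]
  /-- The first embedding. -/
  fst : dom ↪ₑ[L] cod
  /-- The second embedding. -/
  snd : dom ↪ₑ[L] cod

namespace ElementaryPair

attribute [instance] structureDom structureCod nonempty_cod

theorem exists_next {L : Language} (P : ElementaryPair.{u} L) :
    ∃ (Z : Type u) (_ : L.Structure Z) (_ : Nonempty Z) (e f : P.cod ↪ₑ[L] Z),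
      ∀ x, f (P.snd x) = e (P.fst x) := by
  obtain ⟨Z, i₁, i₂, g, k, h⟩ := exists_elementary_amalgam (f := P.snd) (e := P.fst)
    fun φ => by
      have h₁ := P.snd.map_formula φ id
      have h₂ := P.fst.map_formula φ id
      exact h₁.trans h₂.symm
  exact ⟨Z, i₁, i₂, k, g, h⟩

/-- A pair on the codomain of `P` whose composites with the members of `P` agree. -/
noncomputable def next {L : Language} (P : ElementaryPair.{u} L) : ElementaryPair.{u} L :=
  letI := P.exists_next.choose_spec.choose
  haveI := P.exists_next.choose_spec.choose_spec.choose
  { dom := P.cod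
    cod := P.exists_next.choose
    fst := P.exists_next.choose_spec.choose_spec.choose_spec.choose
    snd := P.exists_next.choose_spec.choose_spec.choose_spec.choose_spec.choose }

theorem next_snd_snd {L : Language} (P : ElementaryPair.{u} L) (x : P.dom) :
    P.next.snd (P.snd x) = P.next.fst (P.fst x) :=
  P.exists_next.choose_spec.choose_spec.choose_spec.choose_spec.choose_spec x

/-- The iterates of `next`. -/
noncomputable def iter {L : Language} (P : ElementaryPair.{u} L) : ℕ → ElementaryPair.{u} L
  | 0 => P
  | n + 1 => (P.iter n).next

end ElementaryPair

section Chain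

variable {L : Language} {G : ℕ → Type u} [∀ n, L.Structure (G n)] (ε : ∀ n, G n ↪ₑ[L] G (n + 1))

/-- The transition maps of a chain of elementary embeddings. -/
abbrev chainMap (i j : ℕ) (h : i ≤ j) : G i ↪[L] G j :=
  DirectedSystem.natLERec (fun n => (ε n).toEmbedding) i j h

theorem chainMap_self (i : ℕ) (x : G i) : chainMap ε i i le_rfl x = x :=
  DirectedSystem.map_self' (f := chainMap ε) x

theorem chainMap_succ {i j : ℕ} (h : i ≤ j) (x : G i) :
    chainMap ε i (j + 1) (h.trans j.le_succ) x = ε j (chainMap ε i j h x) := by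
  rw [DirectedSystem.coe_natLERec, DirectedSystem.coe_natLERec]
  exact Nat.leRecOn_succ h x

theorem exists_elementary_eq_chainMap (i j : ℕ) (h : i ≤ j) :
    ∃ g : G i ↪ₑ[L] G j, ⇑g = chainMap ε i j h := by
  induction j, h using Nat.le_induction with
  | base => exact ⟨.refl L _, funext fun x => (chainMap_self ε i x).symm⟩
  | succ j h ih =>
    obtain ⟨g, hg⟩ := ih
    exact ⟨(ε j).comp g, funext fun x => by
      rw [chainMap_succ ε h, ElementaryEmbedding.comp_apply, hg]⟩

/-- The direct limit of a chain of elementary embeddings. -/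
abbrev ChainLimit : Type u := DirectLimit G (chainMap ε)

/-- The canonical elementary embedding into the limit of a chain. -/
noncomputable def ofChain (i : ℕ) : G i ↪ₑ[L] ChainLimit ε where
  toFun := DirectLimit.of L ℕ G (chainMap ε) i
  map_formula' n φ x := by
    have := DirectLimit.realize_of (exists_elementary_eq_chainMap ε) φ i x default
    rwa [Unique.eq_default (_ ∘ default)] at this

theorem ofChain_succ (i : ℕ) (x : G i) : ofChain ε (i + 1) (ε i x) = ofChain ε i x := by
  have h := DirectLimit.of_f (L := L) (f := chainMap ε) (hij := i.le_succ) (x := x)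
  rwa [chainMap_succ ε le_rfl, chainMap_self] at h

theorem exists_ofChain (z : ChainLimit ε) : ∃ i x, ofChain ε i x = z :=
  DirectLimit.exists_of z

/-- A shift of the chain commuting with its transition maps induces a self-embedding of the
limit. -/
theorem exists_embedding_of_shift (φ : ∀ n, G n ↪ₑ[L] G (n + 1))
    (hφ : ∀ n x, φ (n + 1) (ε n x) = ε (n + 1) (φ n x)) :
    ∃ F : ChainLimit ε ↪[L] ChainLimit ε,
      ∀ n x, F (ofChain ε n x) = ofChain ε (n + 1) (φ n x) := by
  refine ⟨DirectLimit.lift L ℕ G (chainMap ε)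
    (fun n => ((ofChain ε (n + 1)).comp (φ n)).toEmbedding) fun i j hij x => ?_,
    fun n x => DirectLimit.lift_of _ _ _⟩
  induction j, hij using Nat.le_induction with
  | base => rw [chainMap_self]
  | succ j hij ih =>
    rw [chainMap_succ ε hij, ← ih]
    simp only [ElementaryEmbedding.coe_toEmbedding, ElementaryEmbedding.comp_apply, hφ]
    exact ofChain_succ ε _ _

/-- Mutually inverse shifts of the chain induce an automorphism of the limit. -/
theorem exists_equiv_of_shifts (φ γ : ∀ n, G n ↪ₑ[L] G (n + 1))
    (hφ : ∀ n x, φ (n + 1) (ε n x) = ε (n + 1) (φ n x))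
    (hγ : ∀ n x, γ (n + 1) (ε n x) = ε (n + 1) (γ n x))
    (hγφ : ∀ n x, γ (n + 1) (φ n x) = ε (n + 1) (ε n x))
    (hφγ : ∀ n x, φ (n + 1) (γ n x) = ε (n + 1) (ε n x)) :
    ∃ σ : ChainLimit ε ≃[L] ChainLimit ε,
      ∀ n x, σ (ofChain ε n x) = ofChain ε (n + 1) (φ n x) := by
  obtain ⟨F, hF⟩ := exists_embedding_of_shift ε φ hφ
  obtain ⟨H, hH⟩ := exists_embedding_of_shift ε γ hγ
  refine ⟨⟨⟨F, H, fun z => ?_, fun z => ?_⟩, F.map_fun, F.map_rel⟩, hF⟩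
  · obtain ⟨i, x, rfl⟩ := exists_ofChain ε z
    rw [hF, hH, hγφ, ofChain_succ, ofChain_succ]
  · obtain ⟨i, x, rfl⟩ := exists_ofChain ε z
    rw [hH, hF, hφγ, ofChain_succ, ofChain_succ]

end Chain

/-- A pair of elementary embeddings becomes conjugate by an automorphism after a further
elementary extension. -/
theorem ElementaryPair.exists_equiv {L : Language} (P : ElementaryPair.{u} L) :
    ∃ (N : Type u) (_ : L.Structure N) (k : P.cod ↪ₑ[L] N) (σ : N ≃[L] N),
      ∀ x, σ (k (P.fst x)) = k (P.snd x) := by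
  let G : ℕ → Type u := fun n => (P.iter (2 * n)).dom
  let e₀ (n : ℕ) : G n ↪ₑ[L] (P.iter (2 * n + 1)).dom := (P.iter (2 * n)).fst
  let f₀ (n : ℕ) : G n ↪ₑ[L] (P.iter (2 * n + 1)).dom := (P.iter (2 * n)).snd
  let e₁ (n : ℕ) : (P.iter (2 * n + 1)).dom ↪ₑ[L] G (n + 1) := (P.iter (2 * n + 1)).fst
  let f₁ (n : ℕ) : (P.iter (2 * n + 1)).dom ↪ₑ[L] G (n + 1) := (P.iter (2 * n + 1)).snd
  have h₀ (n : ℕ) (x : G n) : f₁ n (f₀ n x) = e₁ n (e₀ n x) := (P.iter (2 * n)).next_snd_snd x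
  have h₁ (n : ℕ) (x : (P.iter (2 * n + 1)).dom) :
      f₀ (n + 1) (f₁ n x) = e₀ (n + 1) (e₁ n x) := (P.iter (2 * n + 1)).next_snd_snd x
  let ε (n : ℕ) : G n ↪ₑ[L] G (n + 1) := (e₁ n).comp (e₀ n)
  obtain ⟨σ, hσ⟩ := exists_equiv_of_shifts ε (fun n => (e₁ n).comp (f₀ n))
    (fun n => (f₁ n).comp (e₀ n))
    (fun n x => by simp only [ε, ElementaryEmbedding.comp_apply, ← h₀, h₁])
    (fun n x => by simp only [ε, ElementaryEmbedding.comp_apply, ← h₁, h₀])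
    (fun n x => by simp only [ε, ElementaryEmbedding.comp_apply, ← h₁, h₀])
    (fun n x => by simp only [ε, ElementaryEmbedding.comp_apply, h₁])
  exact ⟨ChainLimit ε, inferInstance, (ofChain ε 1).comp (e₁ 0), σ, fun x =>
    (congrArg σ (ofChain_succ ε 0 x)).trans (hσ 0 x)⟩

end FirstOrder.Language

theorem same_type_conjugate_in_elementary_extension {L : Language} {M : Type u}
    [L.Structure M] (n : ℕ) (a b : Fin n → M)
    (h : ∀ φ : L.Formula (Fin n), φ.Realize a ↔ φ.Realize b) :
    ∃ (N : Type u) (_ : L.Structure N) (e : M ↪ₑ[L] N) (σ : N ≃[L] N),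
      ∀ i : Fin n, σ (e (a i)) = e (b i) := by
  rcases isEmpty_or_nonempty M with hM | hM
  · exact ⟨M, inferInstance, .refl L M, .refl L M, fun i => hM.elim (a i)⟩
  · obtain ⟨Y, _, _, f, e, hfe⟩ := Language.exists_elementary_amalgam h
    obtain ⟨N, _, k, σ, hσ⟩ := Language.ElementaryPair.exists_equiv ⟨M, Y, e, f⟩
    refine ⟨N, inferInstance, k.comp f, σ, fun i => ?_⟩
    rw [Language.ElementaryEmbedding.comp_apply, hfe]
    exact hσ (b i)
end

section
/- The class of simple graphs has the amalgamation property: given simple graphs G on V, H₀ on W₀, and H₁ on W₁, and graph embeddings f₀ : G ↪g H₀ and f₁ : G ↪g H₁, there exist a type U, a simple graph K on U, and graph embeddings h₀ : H₀ ↪g K and h₁ : H₁ ↪g K such that h₀ (f₀ v) = h₁ (f₁ v) for every v : V. -/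
universe u

/-- If two embeddings of vertex sets overlap exactly along a common induced subgraph, then the
union of the two image graphs induces the first graph on the first image. -/
theorem SimpleGraph.map_sup_map_adj_left_iff {V W₀ W₁ U : Type*}
    {G : SimpleGraph V} {H₀ : SimpleGraph W₀} {H₁ : SimpleGraph W₁}
    (f₀ : G ↪g H₀) (f₁ : G ↪g H₁) (i : W₀ ↪ U) (j : W₁ ↪ U)
    (h : ∀ a b, i a = j b → ∃ v, f₀ v = a ∧ f₁ v = b) (a b : W₀) :
    (H₀.map i ⊔ H₁.map j).Adj (i a) (i b) ↔ H₀.Adj a b := by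
  rw [SimpleGraph.sup_adj, SimpleGraph.map_adj_apply, or_iff_left_iff_imp, SimpleGraph.map_adj]
  rintro ⟨c, d, hcd, hc, hd⟩
  obtain ⟨v, rfl, rfl⟩ := h a c hc.symm
  obtain ⟨w, rfl, rfl⟩ := h b d hd.symm
  exact f₀.map_adj_iff.2 (f₁.map_adj_iff.1 hcd)

/-- Injections out of a common type can be amalgamated with no overlap beyond that type. -/
theorem Function.Embedding.exists_strong_amalgam {V W₀ W₁ : Type u}
    (f₀ : V ↪ W₀) (f₁ : V ↪ W₁) :
    ∃ (U : Type u) (i : W₀ ↪ U) (j : W₁ ↪ U), (∀ v, i (f₀ v) = j (f₁ v)) ∧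
      ∀ a b, i a = j b → ∃ v, f₀ v = a ∧ f₁ v = b := by
  classical
  let j : W₁ → W₀ ⊕ W₁ := fun w ↦
    if hw : ∃ v, f₁ v = w then Sum.inl (f₀ hw.choose) else Sum.inr w
  have hj (v : V) : j (f₁ v) = Sum.inl (f₀ v) := by
    have hv : ∃ v', f₁ v' = f₁ v := ⟨v, rfl⟩
    simp only [j, dif_pos hv, f₁.injective hv.choose_spec]
  have hj' (w : W₁) (hw : ¬∃ v, f₁ v = w) : j w = Sum.inr w := dif_neg hw
  have hinj : Function.Injective j := by
    intro a b hab
    by_cases ha : ∃ v, f₁ v = a <;> by_cases hb : ∃ v, f₁ v = b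
    · obtain ⟨v, rfl⟩ := ha
      obtain ⟨w, rfl⟩ := hb
      rw [hj, hj] at hab
      rw [f₀.injective (Sum.inl_injective hab)]
    · obtain ⟨v, rfl⟩ := ha
      simp [hj, hj' b hb] at hab
    · obtain ⟨w, rfl⟩ := hb
      simp [hj, hj' a ha] at hab
    · rw [hj' a ha, hj' b hb] at hab
      exact Sum.inr_injective hab
  refine ⟨W₀ ⊕ W₁, .inl, ⟨j, hinj⟩, fun v ↦ (hj v).symm, fun a b hab ↦ ?_⟩
  change Sum.inl a = j b at hab
  by_cases hb : ∃ v, f₁ v = b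
  · obtain ⟨v, rfl⟩ := hb
    rw [hj] at hab
    exact ⟨v, (Sum.inl_injective hab).symm, rfl⟩
  · simp [hj' b hb] at hab

theorem simpleGraph_amalgamation {V W₀ W₁ : Type u}
    (G : SimpleGraph V) (H₀ : SimpleGraph W₀) (H₁ : SimpleGraph W₁)
    (f₀ : G ↪g H₀) (f₁ : G ↪g H₁) :
    ∃ (U : Type u) (K : SimpleGraph U) (h₀ : H₀ ↪g K) (h₁ : H₁ ↪g K),
      ∀ v : V, h₀ (f₀ v) = h₁ (f₁ v) := by
  obtain ⟨U, i, j, hij, h⟩ :=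
    Function.Embedding.exists_strong_amalgam f₀.toEmbedding f₁.toEmbedding
  refine ⟨U, H₀.map i ⊔ H₁.map j, ⟨i, ?_⟩, ⟨j, ?_⟩, hij⟩
  · intro a b
    exact SimpleGraph.map_sup_map_adj_left_iff f₀ f₁ i j h a b
  · intro a b
    rw [sup_comm]
    exact SimpleGraph.map_sup_map_adj_left_iff f₁ f₀ j i
      (fun a b hab ↦ (h b a hab.symm).imp fun _ ↦ And.symm) a b
end

section
/- Let L be a first-order language, T an L-theory, ι a nonempty linearly ordered type, M : ι → Type a family of L-structures each of which is a model of T, and f : ∀ i j, i ≤ j → (M i ↪[L] M j) a directed system of L-embeddings (so f i i h is the identity, and for i ≤ j ≤ k the composite of f i j with f j k equals f i k). Then there exist an L-structure N that is a model of T and L-embeddings g i : M i ↪[L] N such that for all i ≤ j, (g j) ∘ (f i j h) = g i. -/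
open FirstOrder

universe u v

namespace FirstOrder.Language

variable {L : Language} {ι : Type v} [LinearOrder ι] {M : ι → Type u} [∀ i, L.Structure (M i)]

open Classical in
/-- The thread of an element `x : M i` along a directed system, with an arbitrary value at the
indices `j` for which `i ≤ j` fails. -/
noncomputable def chainThread [∀ i, Nonempty (M i)] (f : ∀ i j : ι, i ≤ j → (M i ↪[L] M j))
    (i : ι) (x : M i) (j : ι) : M j :=
  if h : i ≤ j then f i j h x else Classical.arbitrary (M j)

theorem chainThread_of_le [∀ i, Nonempty (M i)] (f : ∀ i j : ι, i ≤ j → (M i ↪[L] M j))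
    {i j : ι} (h : i ≤ j) (x : M i) : chainThread f i x j = f i j h x := by
  simp [chainThread, h]

open Filter

/-- The embedding of a member of a chain of structures into an ultraproduct of the chain along an
ultrafilter finer than `atTop`. -/
noncomputable def chainToUltraproduct [∀ i, Nonempty (M i)]
    (f : ∀ i j : ι, i ≤ j → (M i ↪[L] M j)) (U : Ultrafilter ι) (hU : (U : Filter ι) ≤ atTop)
    (i : ι) : M i ↪[L] (U : Filter ι).Product M where
  toFun x := Quotient.mk _ (chainThread f i x)
  inj' x y hxy := by
    have h : ∀ᶠ j in (U : Filter ι), chainThread f i x j = chainThread f i y j :=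
      Quotient.exact hxy
    obtain ⟨j, hj, hij⟩ := (h.and (hU (eventually_ge_atTop i))).exists
    rw [chainThread_of_le f hij, chainThread_of_le f hij] at hj
    exact (f i j hij).injective hj
  map_fun' F x := by
    refine Eq.trans ?_ (Ultraproduct.funMap_cast F fun k => chainThread f i (x k)).symm
    refine Quotient.sound (?_ : ∀ᶠ j in (U : Filter ι), _)
    filter_upwards [hU (eventually_ge_atTop i)] with j hij
    simp only [chainThread_of_le f hij]
    exact (f i j hij).map_fun F x
  map_rel' r x := by
    have h : Structure.RelMap r (fun k => (Quotient.mk _ (chainThread f i (x k)) :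
        (U : Filter ι).Product M)) ↔
        ∀ᶠ j in (U : Filter ι), Structure.RelMap r fun k => chainThread f i (x k) j :=
      relMap_quotient_mk' ((U : Filter ι).productSetoid M) r fun k => chainThread f i (x k)
    refine h.trans ?_
    have key : ∀ j, i ≤ j → ((Structure.RelMap r fun k => chainThread f i (x k) j) ↔
        Structure.RelMap r x) := by
      intro j hij
      simp only [chainThread_of_le f hij]
      exact (f i j hij).map_rel r x
    have hge : ∀ᶠ j in (U : Filter ι), i ≤ j := hU (eventually_ge_atTop i)
    rw [eventually_congr (hge.mono key), eventually_const]

theorem chainToUltraproduct_comp [∀ i, Nonempty (M i)] (f : ∀ i j : ι, i ≤ j → (M i ↪[L] M j))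
    (hcomp : ∀ (i j k : ι) (hij : i ≤ j) (hjk : j ≤ k),
      (f j k hjk).comp (f i j hij) = f i k (hij.trans hjk))
    (U : Ultrafilter ι) (hU : (U : Filter ι) ≤ atTop) (i j : ι) (h : i ≤ j) :
    (chainToUltraproduct f U hU j).comp (f i j h) = chainToUltraproduct f U hU i := by
  ext x
  refine Quotient.sound (?_ : ∀ᶠ k in (U : Filter ι), _)
  filter_upwards [hU (eventually_ge_atTop j)] with k hjk
  rw [chainThread_of_le f hjk, chainThread_of_le f (h.trans hjk), ← hcomp i j k h hjk]
  rfl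

theorem exists_upper_bound_of_nonempty [Nonempty ι] [∀ i, Nonempty (M i)] {T : L.Theory}
    (hT : ∀ i, M i ⊨ T) (f : ∀ i j : ι, i ≤ j → (M i ↪[L] M j))
    (hcomp : ∀ (i j k : ι) (hij : i ≤ j) (hjk : j ≤ k),
      (f j k hjk).comp (f i j hij) = f i k (hij.trans hjk)) :
    ∃ (N : Type (max u v)) (_ : L.Structure N), N ⊨ T ∧
      ∃ g : ∀ i : ι, M i ↪[L] N,
        ∀ (i j : ι) (h : i ≤ j), (g j).comp (f i j h) = g i := by
  have hU : ((Ultrafilter.of atTop : Ultrafilter ι) : Filter ι) ≤ atTop := Ultrafilter.of_le _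
  refine ⟨((Ultrafilter.of atTop : Ultrafilter ι) : Filter ι).Product M, inferInstance, ?_,
    chainToUltraproduct f _ hU, chainToUltraproduct_comp f hcomp _ hU⟩
  refine ⟨fun φ hφ => ?_⟩
  rw [Ultraproduct.sentence_realize]
  exact Eventually.of_forall fun i => (hT i).realize_of_mem φ hφ

/-- An embedding between empty structures is an isomorphism. -/
noncomputable def Embedding.equivOfIsEmpty {A B : Type*} [L.Structure A] [L.Structure B]
    [IsEmpty A] [IsEmpty B] (e : A ↪[L] B) : A ≃[L] B where
  toEquiv := Equiv.equivOfIsEmpty A B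
  map_fun' F x := isEmptyElim (Structure.funMap F x)
  map_rel' r x := by
    rw [← e.map_rel r x]
    exact iff_of_eq (congrArg _ (funext fun k => isEmptyElim (x k)))

theorem exists_upper_bound_of_isEmpty [Nonempty ι] [∀ i, IsEmpty (M i)] {T : L.Theory}
    (hT : ∀ i, M i ⊨ T) (f : ∀ i j : ι, i ≤ j → (M i ↪[L] M j)) :
    ∃ (N : Type (max u v)) (_ : L.Structure N), N ⊨ T ∧
      ∃ g : ∀ i : ι, M i ↪[L] N,
        ∀ (i j : ι) (h : i ≤ j), (g j).comp (f i j h) = g i := by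
  obtain ⟨i₀⟩ := ‹Nonempty ι›
  let e : M i₀ ≃ ULift.{v} (M i₀) := Equiv.ulift.symm
  let _ : L.Structure (ULift.{v} (M i₀)) := e.inducedStructure
  let e' : M i₀ ≃[L] ULift.{v} (M i₀) := e.inducedStructureEquiv
  refine ⟨ULift.{v} (M i₀), inferInstance, ?_, fun i => e'.toEmbedding.comp
    ((f i₀ (max i i₀) (le_max_right _ _)).equivOfIsEmpty.symm.toEmbedding.comp
      (f i (max i i₀) (le_max_left _ _))), ?_⟩
  · exact StrongHomClass.theory_model e'
  · intro i j h
    ext x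
    exact isEmptyElim x

end FirstOrder.Language

open FirstOrder.Language in
theorem chain_of_models_has_upper_bound {L : Language} {ι : Type v}
    [Nonempty ι] [LinearOrder ι] {M : ι → Type u} [∀ i, L.Structure (M i)]
    {T : L.Theory} (hT : ∀ i, M i ⊨ T)
    (f : ∀ i j : ι, i ≤ j → (M i ↪[L] M j))
    (hid : ∀ (i : ι) (h : i ≤ i), f i i h = Language.Embedding.refl L (M i))
    (hcomp : ∀ (i j k : ι) (hij : i ≤ j) (hjk : j ≤ k),
      (f j k hjk).comp (f i j hij) = f i k (hij.trans hjk)) :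
    ∃ (N : Type (max u v)) (_ : L.Structure N), N ⊨ T ∧
      ∃ g : ∀ i : ι, M i ↪[L] N,
        ∀ (i j : ι) (h : i ≤ j), (g j).comp (f i j h) = g i := by
  by_cases hne : ∃ i, Nonempty (M i)
  · obtain ⟨i₀, ⟨x₀⟩⟩ := hne
    have (i : Set.Ici i₀) : Nonempty (M i) := ⟨f i₀ i i.2 x₀⟩
    obtain ⟨N, _, hN, g, hg⟩ := exists_upper_bound_of_nonempty
      (M := fun i : Set.Ici i₀ => M i) (fun i => hT i) (fun i j h => f i j h)
      (fun i j k hij hjk => hcomp i j k hij hjk)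
    let b (i : ι) : Set.Ici i₀ := ⟨max i i₀, Set.mem_Ici.2 (le_max_right _ _)⟩
    have hb (i : ι) : i ≤ b i := le_max_left _ _
    have hmono (i j : ι) (h : i ≤ j) : b i ≤ b j := max_le_max_right i₀ h
    refine ⟨N, inferInstance, hN, fun i => (g (b i)).comp (f i (b i) (hb i)), fun i j h => ?_⟩
    beta_reduce
    rw [Language.Embedding.comp_assoc, hcomp, ← hg (b i) (b j) (hmono i j h),
      Language.Embedding.comp_assoc, hcomp]
  · have (i : ι) : IsEmpty (M i) := not_nonempty_iff.1 fun h => hne ⟨i, h⟩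
    exact exists_upper_bound_of_isEmpty hT f
end

section
/- For a simple graph G on a vertex type V, the following are equivalent: (1) G satisfies the finite pattern property; (2) G is existentially closed in the class of simple graphs, i.e., for every type W, every simple graph H on W, every graph embedding f : G ↪g H, all m n : ℕ, every quantifier-free bounded formula φ : Language.graph.BoundedFormula (Fin m) n, and every valuation xs : Fin m → V, if the existential closure φ.exs is realized at the valuation f ∘ xs in the Language.graph-structure on W induced by H, then φ.exs is realized at xs in the Language.graph-structure on V induced by G. -/
open FirstOrder

universe u

/-- A simple graph satisfies the finite pattern property if any finite pattern of
adjacency and non-adjacency to two disjoint finite sets is realized by some vertex. -/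
def FinitePatternProperty {V : Type u} (G : SimpleGraph V) : Prop :=
  ∀ A B : Finset V, Disjoint A B →
    ∃ v : V, v ∉ A ∧ v ∉ B ∧ (∀ a ∈ A, G.Adj v a) ∧ (∀ b ∈ B, ¬ G.Adj v b)

open Language

/-- Two tuples with the same equality and adjacency patterns satisfy the same quantifier-free
formulas in the language of graphs. -/
theorem realize_iff_of_same_pattern {V W α : Type*} {G : SimpleGraph V} {H : SimpleGraph W} {n : ℕ}
    {φ : Language.graph.BoundedFormula α n} (hφ : φ.IsQF)
    {v : α → V} {xs : Fin n → V} {w : α → W} {ys : Fin n → W}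
    (heq : ∀ i j, Sum.elim v xs i = Sum.elim v xs j ↔ Sum.elim w ys i = Sum.elim w ys j)
    (hadj : ∀ i j, G.Adj (Sum.elim v xs i) (Sum.elim v xs j) ↔
      H.Adj (Sum.elim w ys i) (Sum.elim w ys j)) :
    (letI := G.structure; φ.Realize v xs) ↔ (letI := H.structure; φ.Realize w ys) := by
  induction hφ with
  | falsum => rfl
  | of_isAtomic h =>
    cases h with
    | equal t₁ t₂ =>
      rcases t₁ with i | ⟨f, _⟩
      · rcases t₂ with j | ⟨f, _⟩
        · exact heq i j
        · exact isEmptyElim f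
      · exact isEmptyElim f
    | rel R ts =>
      cases R
      rcases h₀ : ts 0 with i | ⟨f, _⟩
      · rcases h₁ : ts 1 with j | ⟨f, _⟩
        · let _ := G.structure
          let _ := H.structure
          change G.Adj ((ts 0).realize (Sum.elim v xs)) ((ts 1).realize (Sum.elim v xs)) ↔
            H.Adj ((ts 0).realize (Sum.elim w ys)) ((ts 1).realize (Sum.elim w ys))
          rw [h₀, h₁]
          exact hadj i j
        · exact isEmptyElim f
      · exact isEmptyElim f
  | imp _ _ ih₁ ih₂ => exact imp_congr ih₁ ih₂

/-- In a graph with the finite pattern property, a finite partial isomorphism from another graph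
extends to any further finite set of vertices. -/
theorem FinitePatternProperty.exists_extension {V W : Type*} [DecidableEq W]
    {G : SimpleGraph V} (hG : FinitePatternProperty G) (H : SimpleGraph W) (S T : Finset W) (g₀ : W → V)
    (hinj : Set.InjOn g₀ S) (hadj : ∀ x ∈ S, ∀ y ∈ S, G.Adj (g₀ x) (g₀ y) ↔ H.Adj x y) :
    ∃ g : W → V, Set.EqOn g g₀ S ∧ (∀ x ∈ S ∪ T, ∀ y ∈ S ∪ T, g x = g y ↔ x = y) ∧
      ∀ x ∈ S ∪ T, ∀ y ∈ S ∪ T, G.Adj (g x) (g y) ↔ H.Adj x y := by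
  classical
  induction T using Finset.induction_on with
  | empty =>
    refine ⟨g₀, fun _ _ => rfl, fun x hx y hy => ?_, by simpa using hadj⟩
    exact hinj.eq_iff (by simpa using hx) (by simpa using hy)
  | insert w T _ ih =>
    obtain ⟨g, hg₀, hgeq, hgadj⟩ := ih
    rw [Finset.union_insert]
    by_cases hw : w ∈ S ∪ T
    · rw [Finset.insert_eq_self.2 hw]
      exact ⟨g, hg₀, hgeq, hgadj⟩
    have hne : ∀ x ∈ S ∪ T, x ≠ w := fun x hx hxw => hw (hxw ▸ hx)
    obtain ⟨v, hvA, hvB, hA, hB⟩ := hG (((S ∪ T).filter (H.Adj w)).image g)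
      (((S ∪ T).filter fun x => ¬ H.Adj w x).image g) (by
        simp only [Finset.disjoint_left, Finset.mem_image, Finset.mem_filter]
        rintro _ ⟨x, ⟨hx, hwx⟩, rfl⟩ ⟨y, ⟨hy, hwy⟩, hyx⟩
        exact hwy ((hgeq y hy x hx).1 hyx ▸ hwx))
    have hv : ∀ x ∈ S ∪ T, v ≠ g x ∧ (G.Adj v (g x) ↔ H.Adj w x) := by
      intro x hx
      by_cases hwx : H.Adj w x
      · have hmem := Finset.mem_image_of_mem g (Finset.mem_filter.2 ⟨hx, hwx⟩)
        exact ⟨fun hvx => hvA (hvx ▸ hmem), iff_of_true (hA _ hmem) hwx⟩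
      · have hmem := Finset.mem_image_of_mem g
          ((Finset.mem_filter (p := fun x => ¬ H.Adj w x)).2 ⟨hx, hwx⟩)
        exact ⟨fun hvx => hvB (hvx ▸ hmem), iff_of_false (hB _ hmem) hwx⟩
    refine ⟨Function.update g w v, fun x hx => ?_, fun x hx y hy => ?_, fun x hx y hy => ?_⟩
    · rw [Function.update_of_ne (hne x (Finset.mem_union_left _ hx)), hg₀ hx]
    · rcases Finset.mem_insert.1 hx with rfl | hxU <;> rcases Finset.mem_insert.1 hy with rfl | hyU
      · simp
      · simp [Function.update_of_ne (hne y hyU), (hv y hyU).1, (hne y hyU).symm]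
      · simp [(hv x hxU).1.symm, hne x hxU]
      · simp [Function.update_of_ne (hne x hxU), Function.update_of_ne (hne y hyU), hgeq x hxU y hyU]
    · rcases Finset.mem_insert.1 hx with rfl | hxU <;> rcases Finset.mem_insert.1 hy with rfl | hyU
      · simp
      · simp [Function.update_of_ne (hne y hyU), (hv y hyU).2]
      · simp [Function.update_of_ne (hne x hxU), G.adj_comm _ v, (hv x hxU).2, H.adj_comm x]
      · simp [Function.update_of_ne (hne x hxU), Function.update_of_ne (hne y hyU), hgadj x hxU y hyU]

theorem FirstOrder.Language.BoundedFormula.isQF_iInf {L : Language} {α β : Type*} [Finite β] {n : ℕ}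
    {f : β → L.BoundedFormula α n} (hf : ∀ b, (f b).IsQF) : (BoundedFormula.iInf f).IsQF := by
  have aux : ∀ l : List (L.BoundedFormula α n), (∀ φ ∈ l, φ.IsQF) →
      (l.foldr (· ⊓ ·) ⊤).IsQF := by
    intro l hl
    induction l with
    | nil => exact BoundedFormula.IsQF.top
    | cons φ l ih =>
      exact (hl φ (by simp)).inf (ih fun ψ hψ => hl ψ (by simp [hψ]))
  refine aux _ fun φ hφ => ?_
  obtain ⟨b, -, rfl⟩ := List.mem_map.1 hφ
  exact hf b

/-- Add one vertex to a graph, adjacent exactly to the vertices in a given set. -/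
def SimpleGraph.addVertex {V : Type*} (G : SimpleGraph V) (A : Set V) :
    SimpleGraph (Option V) where
  Adj
    | none, none => False
    | none, some a => a ∈ A
    | some a, none => a ∈ A
    | some a, some b => G.Adj a b
  symm := ⟨by
    rintro (_ | a) (_ | b) h
    exacts [h, h, h, G.symm.symm _ _ h]⟩
  loopless := ⟨by
    rintro (_ | a) h
    exacts [h, G.irrefl h]⟩

theorem finitePatternProperty_iff_existentiallyClosed {V : Type u} (G : SimpleGraph V) :
    FinitePatternProperty G ↔
      ∀ (W : Type u) (H : SimpleGraph W) (f : G ↪g H) (m n : ℕ)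
        (φ : Language.graph.BoundedFormula (Fin m) n), φ.IsQF →
        ∀ xs : Fin m → V,
          (letI := H.structure; φ.exs.Realize (⇑f ∘ xs)) →
          (letI := G.structure; φ.exs.Realize xs) := by
  classical
  constructor
  · intro hG W H f m n φ hφ xs h
    let _ := G.structure
    let _ := H.structure
    rw [BoundedFormula.realize_exs] at h ⊢
    obtain ⟨ys, hys⟩ := h
    obtain ⟨v₀, -⟩ := hG ∅ ∅ (Finset.disjoint_empty_left _)
    have : Nonempty V := ⟨v₀⟩
    have hinv : Function.LeftInverse (Function.invFun f) f :=
      Function.leftInverse_invFun f.injective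
    obtain ⟨g, hg, heq, hadj⟩ := hG.exists_extension H (Finset.univ.image (f ∘ xs))
      (Finset.univ.image ys) (Function.invFun f)
      (by
        intro x hx y hy hxy
        simp only [Finset.coe_image, Finset.coe_univ, Set.image_univ] at hx hy
        obtain ⟨i, rfl⟩ := hx
        obtain ⟨j, rfl⟩ := hy
        simp only [Function.comp_apply, hinv _] at hxy ⊢
        rw [hxy])
      (by simp [hinv _])
    have hmem : ∀ i, Sum.elim (f ∘ xs) ys i ∈
        Finset.univ.image (f ∘ xs) ∪ Finset.univ.image ys := by
      rintro (i | i) <;> simp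
    have hcomp : ∀ i, Sum.elim xs (g ∘ ys) i = g (Sum.elim (f ∘ xs) ys i) := by
      rintro (i | i)
      · simpa [hinv _] using (hg (show (f ∘ xs) i ∈ _ by simp)).symm
      · rfl
    refine ⟨g ∘ ys, (realize_iff_of_same_pattern hφ (fun i j => ?_) fun i j => ?_).2 hys⟩
    · rw [hcomp, hcomp, heq _ (hmem i) _ (hmem j)]
    · rw [hcomp, hcomp, hadj _ (hmem i) _ (hmem j)]
  · intro h A B hAB
    let e := (A ∪ B).equivFin
    let xs : Fin (A ∪ B).card → V := fun i => e.symm i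
    let y : Language.graph.Term (Fin (A ∪ B).card ⊕ Fin 1) := Term.var (Sum.inr 0)
    let x (i : Fin (A ∪ B).card) : Language.graph.Term (Fin (A ∪ B).card ⊕ Fin 1) :=
      Term.var (Sum.inl i)
    let ψ (i : Fin (A ∪ B).card) : Language.graph.BoundedFormula (Fin (A ∪ B).card) 1 :=
      (y.bdEqual (x i)).not ⊓
        if xs i ∈ A then adj.boundedFormula₂ y (x i) else (adj.boundedFormula₂ y (x i)).not
    have hψ : ∀ i, (ψ i).IsQF := by
      intro i
      refine (BoundedFormula.IsAtomic.equal _ _).isQF.not.inf ?_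
      split_ifs
      · exact (BoundedFormula.IsAtomic.rel _ _).isQF
      · exact (BoundedFormula.IsAtomic.rel _ _).isQF.not
    have realize_ψ : ∀ {U : Type u} (K : SimpleGraph U) (i) (v : Fin (A ∪ B).card → U)
        (z : Fin 1 → U), (letI := K.structure; (ψ i).Realize v z) ↔
          z 0 ≠ v i ∧ (K.Adj (z 0) (v i) ↔ xs i ∈ A) := by
      intro U K i v z
      let _ := K.structure
      have hadj : (adj.boundedFormula₂ y (x i)).Realize v z ↔ K.Adj (z 0) (v i) :=
        BoundedFormula.realize_rel₂
      simp only [ψ, BoundedFormula.realize_inf, BoundedFormula.realize_not]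
      refine and_congr Iff.rfl ?_
      split_ifs with hi
      · simp [hadj, hi]
      · simp [hadj, hi]
    let f : G ↪g G.addVertex A := ⟨Function.Embedding.some, Iff.rfl⟩
    have key := h (Option V) (G.addVertex A) f _ 1 _ (BoundedFormula.isQF_iInf hψ) xs (by
      let _ := (G.addVertex A).structure
      rw [BoundedFormula.realize_exs]
      refine ⟨fun _ => none, ?_⟩
      rw [BoundedFormula.realize_iInf]
      exact fun i => (realize_ψ _ i _ _).2 ⟨(Option.some_ne_none _).symm, Iff.rfl⟩)
    let _ := G.structure
    rw [BoundedFormula.realize_exs] at key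
    obtain ⟨z, hz⟩ := key
    rw [BoundedFormula.realize_iInf] at hz
    have hz' : ∀ a ∈ A ∪ B, z 0 ≠ a ∧ (G.Adj (z 0) a ↔ a ∈ A) := by
      intro a ha
      simpa [xs] using (realize_ψ G (e ⟨a, ha⟩) xs z).1 (hz _)
    have hzA := fun a ha => hz' a (Finset.mem_union_left B ha)
    have hzB := fun b hb => hz' b (Finset.mem_union_right A hb)
    exact ⟨z 0, fun hA => (hzA _ hA).1 rfl, fun hB => (hzB _ hB).1 rfl,
      fun a ha => (hzA a ha).2.2 ha,
      fun b hb hadj => Finset.disjoint_left.1 hAB ((hzB b hb).2.1 hadj) hb⟩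
end

section
/- For a simple graph G on a vertex type V, the following are equivalent: (1) G is universal for finite graphs, i.e., for every finite type F and every simple graph K on F there exists a graph embedding K ↪g G; (2) G is sententially existentially closed in the class of simple graphs, i.e., for every type W, every simple graph H on W, every graph embedding f : G ↪g H, every n : ℕ, and every quantifier-free bounded formula φ : Language.graph.BoundedFormula Empty n, if the sentence φ.exs holds in the Language.graph-structure on W induced by H, then φ.exs holds in the Language.graph-structure on V induced by G. -/
open FirstOrder

universe u

namespace FirstOrder.Language.BoundedFormula

variable {L : Language} {α β : Type*} {n : ℕ}

theorem IsQF.foldr_inf {l : List (L.BoundedFormula α n)} (h : ∀ φ ∈ l, φ.IsQF) :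
    (l.foldr (· ⊓ ·) ⊤).IsQF := by
  induction l with
  | nil => exact IsQF.top
  | cons φ l ih =>
    exact (h φ List.mem_cons_self).inf (ih fun ψ hψ => h ψ (List.mem_cons_of_mem φ hψ))

theorem IsQF.iInf [Finite β] {f : β → L.BoundedFormula α n} (h : ∀ b, (f b).IsQF) :
    (BoundedFormula.iInf f).IsQF :=
  IsQF.foldr_inf fun φ hφ => by
    obtain ⟨b, -, rfl⟩ := List.mem_map.mp hφ
    exact h b

end FirstOrder.Language.BoundedFormula

namespace SimpleGraph

open FirstOrder.Language FirstOrder.Language.BoundedFormula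

variable {V W : Type*} {n : ℕ}

/-- A graph embedding, viewed as an embedding of structures in the language of graphs. -/
def Embedding.toStructureEmbedding {G : SimpleGraph V} {H : SimpleGraph W} (f : G ↪g H) :
    letI := G.structure
    letI := H.structure
    V ↪[Language.graph] W :=
  letI := G.structure
  letI := H.structure
  { toEmbedding := f.toEmbedding
    map_fun' := fun c => isEmptyElim c
    map_rel' := fun r x => by
      cases r
      exact f.map_adj_iff }

open Classical in
/-- The quantifier-free formula stating that `n` variables are pairwise distinct and induce
the graph `K`. -/
noncomputable def diagram (K : SimpleGraph (Fin n)) : Language.graph.BoundedFormula Empty n :=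
  BoundedFormula.iInf fun p : Fin n × Fin n =>
    (if p.1 = p.2 then ⊤ else ∼((&p.1).bdEqual &p.2)) ⊓
      (if K.Adj p.1 p.2 then adj.boundedFormula₂ &p.1 &p.2
        else ∼(adj.boundedFormula₂ &p.1 &p.2))

theorem isQF_diagram (K : SimpleGraph (Fin n)) : K.diagram.IsQF := by
  refine IsQF.iInf fun p => IsQF.inf ?_ ?_
  · split_ifs
    · exact IsQF.top
    · exact (IsAtomic.equal _ _).isQF.not
  · split_ifs
    · exact (IsAtomic.rel _ _).isQF
    · exact (IsAtomic.rel _ _).isQF.not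

theorem realize_diagram (K : SimpleGraph (Fin n)) (G : SimpleGraph V) {v : Empty → V}
    {xs : Fin n → V} :
    (letI := G.structure; K.diagram.Realize v xs) ↔
      Function.Injective xs ∧ ∀ i j, G.Adj (xs i) (xs j) ↔ K.Adj i j := by
  let := G.structure
  have relMap_adj (x y : V) : Structure.RelMap adj ![x, y] ↔ G.Adj x y := Iff.rfl
  simp only [diagram, BoundedFormula.realize_iInf, Prod.forall, realize_inf, forall_and,
    Function.Injective]
  refine and_congr (forall₂_congr fun i j => ?_) (forall₂_congr fun i j => ?_)
  · split_ifs with h <;> simp [h]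
  · split_ifs with h <;> simp [h, realize_rel₂, relMap_adj]

theorem exists_realize_diagram_iff (K : SimpleGraph (Fin n)) (G : SimpleGraph V) :
    (letI := G.structure; V ⊨ K.diagram.exs) ↔ Nonempty (K ↪g G) := by
  let := G.structure
  refine BoundedFormula.realize_exs.trans ?_
  simp only [realize_diagram]
  constructor
  · rintro ⟨xs, hinj, hadj⟩
    exact ⟨⟨⟨xs, hinj⟩, hadj _ _⟩⟩
  · rintro ⟨f⟩
    exact ⟨f, f.injective, fun _ _ => f.map_adj_iff⟩

theorem realize_exs_of_embeds_finite {G : SimpleGraph V} {H : SimpleGraph W}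
    (h : ∀ s : Set W, s.Finite → Nonempty (H.induce s ↪g G))
    {φ : Language.graph.BoundedFormula Empty n} (hφ : φ.IsQF)
    (hH : letI := H.structure; W ⊨ φ.exs) :
    letI := G.structure; V ⊨ φ.exs := by
  let := G.structure
  let := H.structure
  obtain ⟨xs, hxs⟩ := BoundedFormula.realize_exs.mp hH
  let := (H.induce (Set.range xs)).structure
  obtain ⟨g⟩ := h (Set.range xs) (Set.finite_range xs)
  let ys : Fin n → Set.range xs := Set.rangeFactorization xs
  have hys : φ.Realize default ys := by
    rw [← hφ.realize_embedding (Embedding.induce (G := H) (Set.range xs)).toStructureEmbedding]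
    convert hxs
    rfl
  refine BoundedFormula.realize_exs.mpr ⟨g ∘ ys, ?_⟩
  convert (hφ.realize_embedding g.toStructureEmbedding).mpr hys
  rfl

end SimpleGraph

theorem universal_for_finite_iff_sententially_existentiallyClosed
    {V : Type u} (G : SimpleGraph V) :
    (∀ (F : Type u) (_ : Finite F) (K : SimpleGraph F), Nonempty (K ↪g G)) ↔
      ∀ (W : Type u) (H : SimpleGraph W) (_f : G ↪g H) (n : ℕ)
        (φ : Language.graph.BoundedFormula Empty n), φ.IsQF →
        (letI := H.structure; W ⊨ φ.exs) →
        (letI := G.structure; V ⊨ φ.exs) := by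
  constructor
  · intro h W H _ n φ hφ hH
    exact SimpleGraph.realize_exs_of_embeds_finite (fun s hs => h s hs.to_subtype _) hφ hH
  · intro h F _ K
    obtain ⟨n, ⟨e⟩⟩ := Finite.exists_equiv_fin F
    let K' : SimpleGraph (Fin n) := K.comap e.symm
    let i : K' ≃g K := SimpleGraph.Iso.comap e.symm K
    obtain ⟨f⟩ := (K'.exists_realize_diagram_iff G).mp <|
      h (V ⊕ F) (G ⊕g K) SimpleGraph.Embedding.sumInl n K'.diagram K'.isQF_diagram <|
        (K'.exists_realize_diagram_iff (G ⊕g K)).mpr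
          ⟨SimpleGraph.Embedding.sumInr.comp i.toEmbedding⟩
    exact ⟨f.comp i.symm.toEmbedding⟩
end

section
/- If G is a simple graph on a countable type V and G' is a simple graph on a countable type V', and both G and G' satisfy the finite pattern property, then there exists a graph isomorphism G ≃g G'. -/
universe u v

/-- A finite set of pairs is a finite partial isomorphism if it is the graph of an injective
partial map which preserves and reflects adjacency. -/
def IsFinitePartialIso {V : Type u} {V' : Type v} (G : SimpleGraph V) (G' : SimpleGraph V')
    (f : Finset (V × V')) : Prop :=
  ∀ p ∈ f, ∀ q ∈ f, (p.1 = q.1 ↔ p.2 = q.2) ∧ (G.Adj p.1 q.1 ↔ G'.Adj p.2 q.2)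

namespace IsFinitePartialIso

variable {V : Type u} {V' : Type v} {G : SimpleGraph V} {G' : SimpleGraph V'}
  {f : Finset (V × V')}

theorem empty : IsFinitePartialIso G G' ∅ := by
  simp [IsFinitePartialIso]

theorem map_prodComm (hf : IsFinitePartialIso G G' f) :
    IsFinitePartialIso G' G (f.map (Equiv.prodComm V V').toEmbedding) := by
  intro p hp q hq
  obtain ⟨p, hp', rfl⟩ := Finset.mem_map.1 hp
  obtain ⟨q, hq', rfl⟩ := Finset.mem_map.1 hq
  exact ⟨(hf p hp' q hq').1.symm, (hf p hp' q hq').2.symm⟩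

/-- If the codomain has the finite pattern property, a finite partial isomorphism extends to any
given vertex of the domain. -/
theorem exists_extend_left (hG' : FinitePatternProperty G') (hf : IsFinitePartialIso G G' f)
    (a : V) : ∃ g, IsFinitePartialIso G G' g ∧ (∃ b, (a, b) ∈ g) ∧ f ⊆ g := by
  classical
  by_cases ha : ∃ b, (a, b) ∈ f
  · exact ⟨f, hf, ha, subset_rfl⟩
  have hdisj : Disjoint ((f.filter fun p => G.Adj a p.1).image Prod.snd)
      ((f.filter fun p => ¬ G.Adj a p.1).image Prod.snd) := by
    rw [Finset.disjoint_left]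
    intro y hy hy'
    simp only [Finset.mem_image, Finset.mem_filter] at hy hy'
    obtain ⟨p, ⟨hp, hpa⟩, rfl⟩ := hy
    obtain ⟨q, ⟨hq, hqa⟩, hqp⟩ := hy'
    exact hqa ((hf q hq p hp).1.2 hqp ▸ hpa)
  obtain ⟨b, hbA, hbB, hadj, hnadj⟩ := hG' _ _ hdisj
  have hb : ∀ p ∈ f, p.1 ≠ a ∧ p.2 ≠ b ∧ (G.Adj a p.1 ↔ G'.Adj b p.2) := by
    intro p hp
    refine ⟨fun h => ha ⟨p.2, h ▸ hp⟩, ?_⟩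
    by_cases h : G.Adj a p.1
    · have hmem := Finset.mem_image_of_mem Prod.snd
        (Finset.mem_filter.2 ⟨hp, h⟩ : p ∈ f.filter fun p => G.Adj a p.1)
      exact ⟨fun e => hbA (e ▸ hmem), iff_of_true h (hadj _ hmem)⟩
    · have hmem := Finset.mem_image_of_mem Prod.snd
        (Finset.mem_filter.2 ⟨hp, h⟩ : p ∈ f.filter fun p => ¬ G.Adj a p.1)
      exact ⟨fun e => hbB (e ▸ hmem), iff_of_false h (hnadj _ hmem)⟩
  refine ⟨insert (a, b) f, ?_, ⟨b, Finset.mem_insert_self _ _⟩, Finset.subset_insert _ _⟩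
  intro p hp q hq
  rcases Finset.mem_insert.1 hp with rfl | hp <;> rcases Finset.mem_insert.1 hq with rfl | hq
  · simp
  · obtain ⟨h₁, h₂, h₃⟩ := hb q hq
    exact ⟨iff_of_false h₁.symm h₂.symm, h₃⟩
  · obtain ⟨h₁, h₂, h₃⟩ := hb p hp
    exact ⟨iff_of_false h₁ h₂, by rw [G.adj_comm, h₃, G'.adj_comm]⟩
  · exact hf p hp q hq

/-- If the domain has the finite pattern property, a finite partial isomorphism extends so as to
attain any given vertex of the codomain. -/
theorem exists_extend_right (hG : FinitePatternProperty G) (hf : IsFinitePartialIso G G' f)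
    (b : V') : ∃ g, IsFinitePartialIso G G' g ∧ (∃ a, (a, b) ∈ g) ∧ f ⊆ g := by
  obtain ⟨g, hg, ⟨a, ha⟩, hfg⟩ := hf.map_prodComm.exists_extend_left hG b
  refine ⟨_, hg.map_prodComm, ⟨a, Finset.mem_map_of_mem _ ha⟩, fun p hp => ?_⟩
  exact Finset.mem_map_of_mem (Equiv.prodComm V' V).toEmbedding
    (hfg (Finset.mem_map_of_mem (Equiv.prodComm V V').toEmbedding hp))

end IsFinitePartialIso

theorem countable_finitePatternProperty_iso {V : Type u} {V' : Type v}
    [Countable V] [Countable V'] (G : SimpleGraph V) (G' : SimpleGraph V')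
    (hG : FinitePatternProperty G) (hG' : FinitePatternProperty G') :
    Nonempty (G ≃g G') := by
  cases nonempty_encodable V
  cases nonempty_encodable V'
  let P := {f : Finset (V × V') // IsFinitePartialIso G G' f}
  let D : V ⊕ V' → Order.Cofinal P := Sum.elim
    (fun a =>
      { carrier := {f | ∃ b, (a, b) ∈ f.1}
        isCofinal := fun f =>
          let ⟨g, hg, hmem, hle⟩ := f.2.exists_extend_left hG' a
          ⟨⟨g, hg⟩, hmem, hle⟩ })
    (fun b =>
      { carrier := {f | ∃ a, (a, b) ∈ f.1}
        isCofinal := fun f =>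
          let ⟨g, hg, hmem, hle⟩ := f.2.exists_extend_right hG b
          ⟨⟨g, hg⟩, hmem, hle⟩ })
  let I : Order.Ideal P := Order.idealOfCofinals ⟨∅, .empty⟩ D
  have hleft : ∀ a, ∃ b, ∃ f ∈ I, (a, b) ∈ f.1 := fun a =>
    let ⟨f, ⟨b, hb⟩, hf⟩ := Order.cofinal_meets_idealOfCofinals ⟨∅, .empty⟩ D (.inl a)
    ⟨b, f, hf, hb⟩
  have hright : ∀ b, ∃ a, ∃ f ∈ I, (a, b) ∈ f.1 := fun b =>
    let ⟨f, ⟨a, ha⟩, hf⟩ := Order.cofinal_meets_idealOfCofinals ⟨∅, .empty⟩ D (.inr b)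
    ⟨a, f, hf, ha⟩
  have hcompat : ∀ p q : V × V', (∃ f ∈ I, p ∈ f.1) → (∃ f ∈ I, q ∈ f.1) →
      (p.1 = q.1 ↔ p.2 = q.2) ∧ (G.Adj p.1 q.1 ↔ G'.Adj p.2 q.2) := by
    rintro p q ⟨f, hf, hp⟩ ⟨g, hg, hq⟩
    obtain ⟨m, -, hfm, hgm⟩ := I.directed f hf g hg
    exact m.2 p (hfm hp) q (hgm hq)
  choose φ hφ using hleft
  choose ψ hψ using hright
  exact ⟨{
    toFun := φ
    invFun := ψ
    left_inv := fun a => (hcompat (_, _) (_, _) (hψ (φ a)) (hφ a)).1.2 rfl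
    right_inv := fun b => (hcompat (_, _) (_, _) (hφ (ψ b)) (hψ b)).1.1 rfl
    map_rel_iff' := fun {a a'} => (hcompat (_, _) (_, _) (hφ a) (hφ a')).2.symm }⟩
end

section
/- If a simple graph G on a vertex type V satisfies the finite pattern property and H is a simple graph on a countable type W, then there exists a graph embedding H ↪g G. -/
universe u v

/-- Choosing the images of `0, 1, 2, …` one at a time embeds any graph on `ℕ` in a graph with the
finite pattern property. -/
theorem FinitePatternProperty.nonempty_embedding_of_nat {V : Type u} {G : SimpleGraph V}
    (hG : FinitePatternProperty G) (K : SimpleGraph ℕ) : Nonempty (K ↪g G) := by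
  classical
  have hG' : ∀ A B : Finset V, ∃ v : V, (∀ a ∈ A, G.Adj v a) ∧ (∀ b ∈ B, v ≠ b) ∧
      ∀ b ∈ B, b ∉ A → ¬ G.Adj v b := fun A B ↦ by
    obtain ⟨v, hA, hB, h, h'⟩ := hG A (B \ A) Finset.disjoint_sdiff
    exact ⟨v, h, fun b hb hv ↦ hB (Finset.mem_sdiff.2 ⟨hv ▸ hb, hA⟩),
      fun b hb hbA ↦ h' b (Finset.mem_sdiff.2 ⟨hb, hbA⟩)⟩
  choose v hadj hne_right hnadj using hG'
  let F : ∀ n : ℕ, (∀ m, m < n → V) → V := fun n g ↦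
    v ((Finset.univ.filter fun i : Fin n ↦ K.Adj n i).image fun i : Fin n ↦ g i i.2)
      ((Finset.univ.filter fun i : Fin n ↦ ¬ K.Adj n i).image fun i : Fin n ↦ g i i.2)
  let f : ℕ → V := Nat.lt_wfRel.wf.fix F
  have hf : ∀ n, f n = F n fun m _ ↦ f m := Nat.lt_wfRel.wf.fix_eq F
  have hne : ∀ m n, m < n → f n ≠ f m := by
    intro m n hmn
    rw [hf n]
    by_cases hK : K.Adj n m
    · exact G.ne_of_adj (hadj _ _ _ (Finset.mem_image.2 ⟨⟨m, hmn⟩, by simpa using hK, rfl⟩))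
    · exact hne_right _ _ _ (Finset.mem_image.2 ⟨⟨m, hmn⟩, by simpa using hK, rfl⟩)
  have hinj : Function.Injective f := .of_lt_imp_ne fun m n h ↦ (hne m n h).symm
  have hlt : ∀ m n, m < n → (G.Adj (f n) (f m) ↔ K.Adj n m) := by
    intro m n hmn
    rw [hf n]
    refine ⟨not_imp_not.1 fun hK ↦ hnadj _ _ _
      (Finset.mem_image.2 ⟨⟨m, hmn⟩, by simpa using hK, rfl⟩) fun h ↦ ?_,
      fun hK ↦ hadj _ _ _ (Finset.mem_image.2 ⟨⟨m, hmn⟩, by simpa using hK, rfl⟩)⟩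
    obtain ⟨i, hi, him⟩ := Finset.mem_image.1 h
    exact hK (hinj him ▸ (Finset.mem_filter.1 hi).2)
  refine ⟨⟨⟨f, hinj⟩, fun {m n} ↦ ?_⟩⟩
  rcases lt_trichotomy m n with h | rfl | h
  · simpa [G.adj_comm, K.adj_comm] using hlt m n h
  · simp
  · exact hlt n m h

theorem finitePatternProperty_universal {V : Type u} {W : Type v} [Countable W]
    (G : SimpleGraph V) (H : SimpleGraph W)
    (hG : FinitePatternProperty G) :
    Nonempty (H ↪g G) := by
  obtain ⟨e, he⟩ := exists_injective_nat W
  obtain ⟨g⟩ := hG.nonempty_embedding_of_nat (H.map e)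
  exact ⟨g.comp (SimpleGraph.Embedding.map ⟨e, he⟩ H)⟩
end

section
/- Let G be a simple graph on a vertex type V satisfying the finite pattern property, let H be a simple graph on a countable type W, let f : G ↪g H be a graph embedding, and let s : Finset V be a finite set of vertices. Then there exists a graph embedding k : H ↪g G such that k (f a) = a for every a ∈ s. -/
universe u v

namespace SimpleGraph

/-- A finite partial embedding of `H` into `G`, encoded as the finite set of pairs it matches. -/
def FinitePartialEmbedding {V : Type u} {W : Type v} (H : SimpleGraph W) (G : SimpleGraph V) :
    Type (max u v) :=
  {r : Finset (W × V) // ∀ p ∈ r, ∀ q ∈ r,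
    (p.1 = q.1 ↔ p.2 = q.2) ∧ (H.Adj p.1 q.1 ↔ G.Adj p.2 q.2)}

namespace FinitePartialEmbedding

variable {V : Type u} {W : Type v} {G : SimpleGraph V} {H : SimpleGraph W}

instance : Preorder (FinitePartialEmbedding H G) := Preorder.lift fun r ↦ r.val

open scoped Classical in
/-- A finite partial embedding into a graph with the finite pattern property extends to any
further vertex of its source. -/
theorem exists_le_mem (hG : FinitePatternProperty G) (r : FinitePartialEmbedding H G) (w : W) :
    ∃ t : FinitePartialEmbedding H G, (∃ v, (w, v) ∈ t.val) ∧ r ≤ t := by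
  by_cases hw : ∃ v, (w, v) ∈ r.val
  · exact ⟨r, hw, le_rfl⟩
  obtain ⟨v, hvA, hvB, hA, hB⟩ := hG ({p ∈ r.val | H.Adj w p.1}.image Prod.snd)
    ({p ∈ r.val | ¬ H.Adj w p.1}.image Prod.snd) (by
      simp only [Finset.disjoint_left, Finset.mem_image, Finset.mem_filter]
      rintro _ ⟨p, ⟨hp, hwp⟩, rfl⟩ ⟨q, ⟨hq, hwq⟩, hqp⟩
      exact hwq (((r.prop q hq p hp).1.2 hqp) ▸ hwp))
  have h_new (p) (hp : p ∈ r.val) :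
      w ≠ p.1 ∧ v ≠ p.2 ∧ (H.Adj w p.1 ↔ G.Adj v p.2) := by
    have hwp : w ≠ p.1 := by
      rintro rfl
      exact hw ⟨p.2, hp⟩
    simp only [Finset.mem_image, Finset.mem_filter] at hvA hvB hA hB
    by_cases h : H.Adj w p.1
    · exact ⟨hwp, fun hv ↦ hvA ⟨p, ⟨hp, h⟩, hv.symm⟩, iff_of_true h (hA _ ⟨p, ⟨hp, h⟩, rfl⟩)⟩
    · exact ⟨hwp, fun hv ↦ hvB ⟨p, ⟨hp, h⟩, hv.symm⟩, iff_of_false h (hB _ ⟨p, ⟨hp, h⟩, rfl⟩)⟩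
  refine ⟨⟨insert (w, v) r.val, fun p hp q hq ↦ ?_⟩, ⟨v, Finset.mem_insert_self _ _⟩,
    Finset.subset_insert _ _⟩
  rcases Finset.mem_insert.1 hp with rfl | hp <;> rcases Finset.mem_insert.1 hq with rfl | hq
  · simp
  · obtain ⟨h₁, h₂, h₃⟩ := h_new q hq
    exact ⟨iff_of_false h₁ h₂, h₃⟩
  · obtain ⟨h₁, h₂, h₃⟩ := h_new p hp
    exact ⟨iff_of_false h₁.symm h₂.symm, by rwa [H.adj_comm, G.adj_comm]⟩
  · exact r.prop p hp q hq

/-- The finite partial embeddings defined at `w` are cofinal. -/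
def definedAt (hG : FinitePatternProperty G) (w : W) :
    Order.Cofinal (FinitePartialEmbedding H G) where
  carrier := {r | ∃ v, (w, v) ∈ r.val}
  isCofinal r := exists_le_mem hG r w

/-- A finite partial embedding of a countable graph into a graph with the finite pattern property
extends to an embedding. -/
theorem exists_embedding [Countable W] (hG : FinitePatternProperty G)
    (r : FinitePartialEmbedding H G) : ∃ k : H ↪g G, ∀ p ∈ r.val, k p.1 = p.2 := by
  cases nonempty_encodable W
  let I := Order.idealOfCofinals r (definedAt (H := H) hG)
  have h_compat (p q : W × V) (hp : ∃ t ∈ I, p ∈ t.val) (hq : ∃ t ∈ I, q ∈ t.val) :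
      (p.1 = q.1 ↔ p.2 = q.2) ∧ (H.Adj p.1 q.1 ↔ G.Adj p.2 q.2) := by
    obtain ⟨t, ht, hp⟩ := hp
    obtain ⟨t', ht', hq⟩ := hq
    obtain ⟨m, -, hm, hm'⟩ := I.directed t ht t' ht'
    exact m.prop p (hm hp) q (hm' hq)
  have h_total (w : W) : ∃ v, ∃ t ∈ I, (w, v) ∈ t.val := by
    obtain ⟨t, ⟨v, hv⟩, ht⟩ := Order.cofinal_meets_idealOfCofinals r (definedAt (H := H) hG) w
    exact ⟨v, t, ht, hv⟩
  choose k hk using h_total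
  exact ⟨⟨⟨k, fun x y hxy ↦ (h_compat _ _ (hk x) (hk y)).1.2 hxy⟩,
      fun {x y} ↦ (h_compat _ _ (hk x) (hk y)).2.symm⟩,
    fun p hp ↦ (h_compat _ p (hk p.1) ⟨r, Order.mem_idealOfCofinals r _, hp⟩).1.1 rfl⟩

end FinitePartialEmbedding

end SimpleGraph

theorem finitePatternProperty_embedding_fixing_finset {V : Type u} {W : Type v}
    [Countable W] (G : SimpleGraph V) (H : SimpleGraph W)
    (hG : FinitePatternProperty G) (f : G ↪g H) (s : Finset V) :
    ∃ k : H ↪g G, ∀ a ∈ s, k (f a) = a := by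
  classical
  obtain ⟨k, hk⟩ := SimpleGraph.FinitePartialEmbedding.exists_embedding hG
    (⟨s.image fun a ↦ (f a, a), by
      simp only [Finset.mem_image]
      rintro _ ⟨a, -, rfl⟩ _ ⟨b, -, rfl⟩
      exact ⟨f.injective.eq_iff, f.map_adj_iff⟩⟩ : SimpleGraph.FinitePartialEmbedding H G)
  exact ⟨k, fun a ha ↦ hk (f a, a) (Finset.mem_image_of_mem _ ha)⟩
end
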